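/- arXiv:1102.0336 — 10 statements merged into one kernel-verified Lean document; each statement's English description precedes it below -/
import Mathlib

section
/- Let d ≥ 1, r > 0, c, C₁, C₂ > 0, and let ω, ω₁ : ℂ^d → (0,∞) be measurable with C₁⁻¹ ω(z)² ≤ ω(z+w) ω(z−w) ≤ C₁ ω(z)² whenever |z| ≥ 2c and |w| ≤ c/|z|, and with ω₁(z) ≤ C₂ (1+|z|)^{−2d/r} ω(z) for all z. Then there is a constant C₃ > 0, depending only on d, r, c, C₁, C₂, such that for every entire function F : ℂ^d → ℂ with ∫_{ℂ^d} (|F(z)| ω(z))^r dλ(z) < ∞ one has |F(z)| ω₁(z) ≤ C₃ ( ∫_{ℂ^d} (|F(w)| ω(w))^r dλ(w) )^{1/r} for all z with |z| ≥ 2c. -/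
open MeasureTheory Filter
open scoped ENNReal

noncomputable section

/-- `ℂ^d`, identified with `ℝ^{2d}`, with the Euclidean norm. -/
abbrev CSp (d : ℕ) := EuclideanSpace ℂ (Fin d)

instance {d : ℕ} : InnerProductSpace ℝ (CSp d) := InnerProductSpace.complexToReal
instance {d : ℕ} : MeasurableSpace (CSp d) := borel _
instance {d : ℕ} : BorelSpace (CSp d) := ⟨rfl⟩

section

open MeasureTheory Filter Real Metric

/-- Sub-mean value property of `log ‖g‖` for entire `g`. -/
theorem log_norm_le_circleAverage {g : ℂ → ℂ} {c : ℂ} {R : ℝ} (hg : Differentiable ℂ g)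
    (hgc : g c ≠ 0) : Real.log ‖g c‖ ≤ circleAverage (fun z => Real.log ‖g z‖) c R := by
  rcases eq_or_ne R 0 with rfl | hR
  · simp
  have han : AnalyticOnNhd ℂ g (closedBall c |R|) := fun z _ => hg.analyticAt z
  rw [← circleAverage_abs_radius,
    AnalyticOnNhd.circleAverage_log_norm (abs_ne_zero.2 hR) (by simpa using han) hgc, abs_abs]
  refine le_add_of_nonneg_left (finsum_nonneg fun u => ?_)
  by_cases hu : u ∈ closedBall c |R|
  · refine mul_nonneg (by exact_mod_cast MeromorphicOn.AnalyticOnNhd.divisor_nonneg han u) ?_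
    rcases eq_or_ne c u with rfl | hcu
    · simp
    rw [mem_closedBall', dist_eq_norm] at hu
    refine log_nonneg ?_
    rwa [← div_eq_mul_inv, one_le_div (norm_pos_iff.2 (sub_ne_zero.2 hcu))]
  · simp [hu]

/-- Sub-mean value property of `‖g‖ ^ s` for entire `g`. -/
theorem rpow_norm_le_circleAverage {g : ℂ → ℂ} {c : ℂ} {R s : ℝ} (hs : 0 < s)
    (hg : Differentiable ℂ g) : ‖g c‖ ^ s ≤ circleAverage (fun z => ‖g z‖ ^ s) c R := by
  rcases eq_or_ne R 0 with rfl | hR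
  · simp
  rcases eq_or_ne (g c) 0 with hgc | hgc
  · rw [hgc, norm_zero, zero_rpow hs.ne']
    exact circleAverage_nonneg_of_nonneg fun z _ => by positivity
  have hpos : 0 < ‖g c‖ := norm_pos_iff.2 hgc
  have han : AnalyticOnNhd ℂ g Set.univ := fun z _ => hg.analyticAt z
  set φ : ℂ → ℝ := fun z => ‖g c‖ ^ s * (1 - s * log ‖g c‖) + (‖g c‖ ^ s * s) * log ‖g z‖ with hφ
  have hlog : CircleIntegrable (fun z => log ‖g z‖) c R :=
    MeromorphicOn.circleIntegrable_log_norm fun z _ => (hg.analyticAt z).meromorphicAt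
  have hφi : CircleIntegrable φ c R :=
    (circleIntegrable_const _ _ _).add (hlog.const_smul (a := ‖g c‖ ^ s * s))
  have hcod : φ =ᶠ[codiscreteWithin (sphere c |R|)] fun z => if g z = 0 then 0 else φ z := by
    have h : g ⁻¹' {0}ᶜ ∈ codiscrete ℂ := han.preimage_zero_mem_codiscrete hgc
    filter_upwards [codiscreteWithin_mono (Set.subset_univ _) h] with z hz
    exact (if_neg hz).symm
  have hpow : CircleIntegrable (fun z => ‖g z‖ ^ s) c R :=
    (hg.continuous.norm.rpow_const fun _ => Or.inr hs.le).continuousOn.circleIntegrable'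
  calc ‖g c‖ ^ s
      ≤ ‖g c‖ ^ s * (1 - s * log ‖g c‖) +
          (‖g c‖ ^ s * s) * circleAverage (fun z => log ‖g z‖) c R := by
        have := mul_le_mul_of_nonneg_left (log_norm_le_circleAverage (R := R) hg hgc)
          (by positivity : 0 ≤ ‖g c‖ ^ s * s)
        linarith
    _ = circleAverage φ c R := by
        have h := circleAverage_add (circleIntegrable_const (‖g c‖ ^ s * (1 - s * log ‖g c‖)) c R)
          (hlog.const_smul (a := ‖g c‖ ^ s * s))
        rw [circleAverage_const, circleAverage_smul] at h
        exact h.symm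
    _ = circleAverage (fun z => if g z = 0 then 0 else φ z) c R :=
        circleAverage_congr_codiscreteWithin hcod hR
    _ ≤ _ := by
        refine circleAverage_mono (hφi.congr_codiscreteWithin hcod) hpow fun z _ => ?_
        split_ifs with hz
        · positivity
        · have hz' : 0 < ‖g z‖ := norm_pos_iff.2 hz
          have h := add_one_le_exp ((log ‖g z‖ - log ‖g c‖) * s)
          rw [sub_mul, exp_sub, ← rpow_def_of_pos hz', ← rpow_def_of_pos hpos,
            le_div_iff₀ (by positivity)] at h
          rw [hφ]
          linarith

/-- Sub-mean value property of `‖G‖ ^ s` over the circle orbit of a vector. -/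
theorem rpow_norm_le_lintegral_circle_smul {E : Type*} [NormedAddCommGroup E] [NormedSpace ℂ E]
    {G : E → ℂ} {s : ℝ} (hs : 0 < s) (hG : Differentiable ℂ G) (w : E) :
    ENNReal.ofReal (2 * π) * ENNReal.ofReal (‖G 0‖ ^ s) ≤
      ∫⁻ θ in Set.Ioc 0 (2 * π), ENNReal.ofReal (‖G (Circle.exp θ • w)‖ ^ s) := by
  have h := rpow_norm_le_circleAverage (c := 0) (R := 1) (g := fun t : ℂ => G (t • w)) hs
    (by fun_prop)
  have hc : Continuous fun θ : ℝ => ‖G (Circle.exp θ • w)‖ ^ s :=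
    (hG.continuous.comp (by fun_prop)).norm.rpow_const fun _ => Or.inr hs.le
  rw [← ofReal_integral_eq_lintegral_ofReal
    ((hc.intervalIntegrable 0 (2 * π)).1) (.of_forall fun _ => by positivity),
    ← ENNReal.ofReal_mul (by positivity), ← intervalIntegral.integral_of_le (by positivity)]
  refine ENNReal.ofReal_le_ofReal ?_
  rw [circleAverage_def, zero_smul, smul_eq_mul, inv_mul_eq_div, le_div_iff₀ (by positivity),
    mul_comm] at h
  simpa [circleMap, Circle.smul_def] using h

/-- Multiplication by a unimodular scalar, as a real linear isometry. -/
def circleRotation {d : ℕ} (u : Circle) : CSp d ≃ₗᵢ[ℝ] CSp d where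
  toLinearEquiv := DistribMulAction.toLinearEquiv ℝ (CSp d) u
  norm_map' w := (norm_smul (u : ℂ) w).trans (by rw [Circle.norm_coe, one_mul])

/-- Sub-mean value property of `‖G‖ ^ s` over balls of `ℂ^d` centred at the origin. -/
theorem rpow_norm_mul_volume_closedBall_le_lintegral {d : ℕ} {G : CSp d → ℂ} {s : ℝ} (hs : 0 < s)
    (hG : Differentiable ℂ G) (ρ : ℝ) :
    ENNReal.ofReal (‖G 0‖ ^ s) * volume (closedBall (0 : CSp d) ρ) ≤
      ∫⁻ w in closedBall (0 : CSp d) ρ, ENNReal.ofReal (‖G w‖ ^ s) := by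
  have hc : Continuous fun w => ENNReal.ofReal (‖G w‖ ^ s) :=
    ENNReal.continuous_ofReal.comp (hG.continuous.norm.rpow_const fun _ => Or.inr hs.le)
  have hrot (θ : ℝ) :
      ∫⁻ w in closedBall (0 : CSp d) ρ, ENNReal.ofReal (‖G (Circle.exp θ • w)‖ ^ s) =
      ∫⁻ w in closedBall (0 : CSp d) ρ, ENNReal.ofReal (‖G w‖ ^ s) := by
    have := (circleRotation (d := d) (Circle.exp θ)).measurePreserving.setLIntegral_comp_preimage
      (measurableSet_closedBall (x := (0 : CSp d)) (ε := ρ)) hc.measurable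
    rw [LinearIsometryEquiv.preimage_closedBall, map_zero] at this
    exact this
  have hπ : ENNReal.ofReal (2 * π) ≠ 0 := by simp [pi_pos]
  rw [← ENNReal.mul_le_mul_iff_right hπ ENNReal.ofReal_ne_top, ← mul_assoc, ← setLIntegral_const]
  calc _ ≤ ∫⁻ w in closedBall (0 : CSp d) ρ, ∫⁻ θ in Set.Ioc 0 (2 * π),
          ENNReal.ofReal (‖G (Circle.exp θ • w)‖ ^ s) := lintegral_mono fun w =>
        rpow_norm_le_lintegral_circle_smul hs hG w
    _ = ∫⁻ θ in Set.Ioc 0 (2 * π), ∫⁻ w in closedBall (0 : CSp d) ρ,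
          ENNReal.ofReal (‖G (Circle.exp θ • w)‖ ^ s) := by
        refine lintegral_lintegral_swap (Continuous.aemeasurable ?_)
        exact hc.comp (f := fun p : CSp d × ℝ => Circle.exp p.2 • p.1) (by fun_prop)
    _ = _ := by simp [hrot, mul_comm]

/-- If `ω z ^ 2 ≤ C₁ * ω (z + w) * ω (z - w)` for `‖w‖ ≤ ρ`, the weighted value of an entire
function at `z` is controlled by its weighted `L^r` integral. The proof applies the
sub-mean value property to `w ↦ F (z + w) * F (z - w)`. -/
theorem weighted_rpow_mul_volume_le_lintegral {d : ℕ} {r C₁ : ℝ} (hr : 0 < r) (hC₁ : 0 < C₁)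
    {ω : CSp d → ℝ} (hω : Measurable ω) (hpos : ∀ z, 0 < ω z)
    {z : CSp d} {ρ : ℝ} (hz : ∀ w, ‖w‖ ≤ ρ → ω z ^ 2 / C₁ ≤ ω (z + w) * ω (z - w))
    {F : CSp d → ℂ} (hF : Differentiable ℂ F) :
    ENNReal.ofReal ((‖F z‖ * ω z) ^ r) * volume (closedBall (0 : CSp d) ρ) ≤
      ENNReal.ofReal (C₁ ^ (r / 2)) * ∫⁻ w, ENNReal.ofReal ((‖F w‖ * ω w) ^ r) := by
  set f : CSp d → ENNReal := fun w => ENNReal.ofReal ((‖F w‖ * ω w) ^ r) with hf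
  have hfm : Measurable f := by
    have := hF.continuous.measurable
    fun_prop
  have hpt (w : CSp d) (hw : w ∈ closedBall (0 : CSp d) ρ) :
      ENNReal.ofReal (ω z ^ r) * ENNReal.ofReal (‖F (z + w) * F (z - w)‖ ^ (r / 2)) ≤
        ENNReal.ofReal (C₁ ^ (r / 2)) * (2⁻¹ * (f (z + w) + f (z - w))) := by
    have h2 : (2⁻¹ : ENNReal) = ENNReal.ofReal 2⁻¹ := by simp
    have h1 := hz w (by simpa using hw)
    rw [div_le_iff₀ hC₁] at h1
    have hsq (x : ℝ) (hx : 0 ≤ x) : (x ^ (r / 2)) ^ 2 = x ^ r := by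
      rw [← rpow_natCast, ← rpow_mul hx]; congr 1; push_cast; ring
    have hsq' (x : ℝ) (hx : 0 ≤ x) : (x ^ 2) ^ (r / 2) = x ^ r := by
      rw [← rpow_natCast, ← rpow_mul hx]; congr 1; push_cast; ring
    have h3 := rpow_le_rpow (sq_nonneg _) h1 (half_pos hr).le
    have hz₀ := (hpos z).le
    have hp := (hpos (z + w)).le
    have hm := (hpos (z - w)).le
    rw [hf, h2, ← ENNReal.ofReal_add (by positivity) (by positivity),
      ← ENNReal.ofReal_mul (by positivity), ← ENNReal.ofReal_mul (by positivity),
      ← ENNReal.ofReal_mul (by positivity)]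
    refine ENNReal.ofReal_le_ofReal ?_
    rw [hsq' _ (hpos z).le, mul_rpow (by positivity) hC₁.le] at h3
    calc _ ≤ (ω (z + w) * ω (z - w)) ^ (r / 2) * C₁ ^ (r / 2) *
          ‖F (z + w) * F (z - w)‖ ^ (r / 2) := by gcongr
      _ = C₁ ^ (r / 2) * ((‖F (z + w)‖ * ω (z + w)) ^ (r / 2) *
          (‖F (z - w)‖ * ω (z - w)) ^ (r / 2)) := by
        rw [norm_mul, mul_rpow, mul_rpow, mul_rpow, mul_rpow] <;> first | positivity | ring
      _ ≤ _ := by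
        refine mul_le_mul_of_nonneg_left ?_ (by positivity)
        rw [← hsq (‖F (z + w)‖ * ω (z + w)) (by positivity),
          ← hsq (‖F (z - w)‖ * ω (z - w)) (by positivity)]
        linarith [two_mul_le_add_sq ((‖F (z + w)‖ * ω (z + w)) ^ (r / 2))
          ((‖F (z - w)‖ * ω (z - w)) ^ (r / 2))]
  have hG : Differentiable ℂ fun w => F (z + w) * F (z - w) := by fun_prop
  have h0 : (‖F z‖ * ω z) ^ r = ω z ^ r * ‖F (z + 0) * F (z - 0)‖ ^ (r / 2) := by
    rw [add_zero, sub_zero, norm_mul, mul_rpow, mul_rpow, ← rpow_add_of_nonneg, add_halves,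
      mul_comm] <;> first | positivity | exact (hpos z).le
  rw [h0, ENNReal.ofReal_mul (rpow_nonneg (hpos z).le _), mul_assoc]
  calc _ ≤ ENNReal.ofReal (ω z ^ r) * ∫⁻ w in closedBall (0 : CSp d) ρ,
          ENNReal.ofReal (‖F (z + w) * F (z - w)‖ ^ (r / 2)) := by
        gcongr; exact rpow_norm_mul_volume_closedBall_le_lintegral (half_pos hr) hG ρ
    _ = ∫⁻ w in closedBall (0 : CSp d) ρ,
          ENNReal.ofReal (ω z ^ r) * ENNReal.ofReal (‖F (z + w) * F (z - w)‖ ^ (r / 2)) :=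
        (lintegral_const_mul' _ _ ENNReal.ofReal_ne_top).symm
    _ ≤ ∫⁻ w in closedBall (0 : CSp d) ρ,
          ENNReal.ofReal (C₁ ^ (r / 2)) * (2⁻¹ * (f (z + w) + f (z - w))) :=
        setLIntegral_mono' measurableSet_closedBall hpt
    _ ≤ ∫⁻ w, ENNReal.ofReal (C₁ ^ (r / 2)) * (2⁻¹ * (f (z + w) + f (z - w))) :=
        setLIntegral_le_lintegral _ _
    _ = _ := by
        rw [lintegral_const_mul' _ _ ENNReal.ofReal_ne_top, lintegral_const_mul' _ _ (by simp),
          lintegral_add_left (by fun_prop), lintegral_add_left_eq_self, lintegral_sub_left_eq_self,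
          ← two_mul, ← mul_assoc 2⁻¹, ENNReal.inv_mul_cancel (by simp) (by simp), one_mul]

end

open Real Metric in
/-- under condition (L′) for `ω` and the domination `ω₁ ≤ C₂ (1+|z|)^{−2d/r} ω`,
a pointwise bound for entire functions with `∫ (|F| ω)^r dλ < ∞`, with a constant depending
only on `d, r, c, C₁, C₂`. -/
theorem stmt1 (d : ℕ) (hd : 1 ≤ d) (r c C₁ C₂ : ℝ)
    (hr : 0 < r) (hc : 0 < c) (hC₁ : 0 < C₁) (hC₂ : 0 < C₂) :
    ∃ C₃ : ℝ, 0 < C₃ ∧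
      ∀ ω ω₁ : CSp d → ℝ, Measurable ω → (∀ z, 0 < ω z) → (∀ z, 0 < ω₁ z) →
        (∀ z w : CSp d, 2 * c ≤ ‖z‖ → ‖w‖ ≤ c / ‖z‖ →
          ω z ^ 2 / C₁ ≤ ω (z + w) * ω (z - w) ∧ ω (z + w) * ω (z - w) ≤ C₁ * ω z ^ 2) →
        (∀ z : CSp d, ω₁ z ≤ C₂ * (1 + ‖z‖) ^ (-(2 * (d : ℝ)) / r) * ω z) →
        ∀ F : CSp d → ℂ, Differentiable ℂ F →
          (∫⁻ z : CSp d, ENNReal.ofReal ((‖F z‖ * ω z) ^ r)) < ⊤ →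
          ∀ z : CSp d, 2 * c ≤ ‖z‖ →
            ‖F z‖ * ω₁ z ≤
              C₃ * ((∫⁻ w : CSp d, ENNReal.ofReal ((‖F w‖ * ω w) ^ r)).toReal) ^ (1 / r) := by
  set v : ℝ := volume.real (ball (0 : CSp d) 1) with hv
  have hv0 : 0 < v := ENNReal.toReal_pos (measure_ball_pos _ _ one_pos).ne' measure_ball_lt_top.ne
  set K : ℝ := C₁ ^ (r / 2) / (c ^ (2 * d) * v) with hK
  refine ⟨C₂ * K ^ (1 / r), by positivity, ?_⟩
  intro ω ω₁ hω hpos hpos₁ hL hdom F hF hfin z hz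
  have hz0 : 0 < ‖z‖ := by linarith
  have h := ENNReal.toReal_mono (ENNReal.mul_ne_top ENNReal.ofReal_ne_top hfin.ne)
    (weighted_rpow_mul_volume_le_lintegral hr hC₁ hω hpos (fun w hw => (hL z w hz hw).1) hF)
  set I := (∫⁻ w : CSp d, ENNReal.ofReal ((‖F w‖ * ω w) ^ r)).toReal with hI
  have hI0 : 0 ≤ I := ENNReal.toReal_nonneg
  have hp := (hpos z).le
  rw [Measure.addHaar_closedBall _ _ (by positivity), finrank_real_of_complex,
    finrank_euclideanSpace_fin, ENNReal.toReal_mul, ENNReal.toReal_mul, ENNReal.toReal_mul,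
    ENNReal.toReal_ofReal (by positivity), ENNReal.toReal_ofReal (by positivity),
    ENNReal.toReal_ofReal (by positivity), ← hI, ← Measure.real, ← hv, div_pow] at h
  have h1 : (‖F z‖ * ω z) ^ r ≤ K * (1 + ‖z‖) ^ (2 * (d : ℝ)) * I := by
    have h2 : (‖F z‖ * ω z) ^ r ≤ K * ‖z‖ ^ (2 * d) * I := by
      have h3 : (‖F z‖ * ω z) ^ r * (c ^ (2 * d) * v) ≤ C₁ ^ (r / 2) * I * ‖z‖ ^ (2 * d) := by
        rw [← div_le_iff₀ (by positivity)]
        refine le_of_eq_of_le ?_ h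
        ring
      rw [hK, div_mul_eq_mul_div, div_mul_eq_mul_div, le_div_iff₀ (by positivity)]
      linarith
    refine h2.trans ?_
    rw [show 2 * (d : ℝ) = ((2 * d : ℕ) : ℝ) by push_cast; rfl, rpow_natCast]
    gcongr
    linarith
  have h2 : ‖F z‖ * ω z ≤ K ^ (1 / r) * (1 + ‖z‖) ^ (2 * (d : ℝ) / r) * I ^ (1 / r) := by
    have := rpow_le_rpow (by positivity) h1 (one_div_pos.2 hr).le
    rw [← rpow_mul (by positivity), mul_one_div_cancel hr.ne', rpow_one,
      mul_rpow (by positivity) hI0, mul_rpow (by positivity) (by positivity),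
      ← rpow_mul (by positivity), mul_one_div] at this
    exact this
  calc ‖F z‖ * ω₁ z ≤ ‖F z‖ * (C₂ * (1 + ‖z‖) ^ (-(2 * (d : ℝ)) / r) * ω z) := by
        gcongr; exact hdom z
    _ = C₂ * (1 + ‖z‖) ^ (-(2 * (d : ℝ)) / r) * (‖F z‖ * ω z) := by ring
    _ ≤ C₂ * (1 + ‖z‖) ^ (-(2 * (d : ℝ)) / r) *
          (K ^ (1 / r) * (1 + ‖z‖) ^ (2 * (d : ℝ) / r) * I ^ (1 / r)) := by gcongr
    _ = C₂ * K ^ (1 / r) * I ^ (1 / r) *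
          ((1 + ‖z‖) ^ (-(2 * (d : ℝ)) / r) * (1 + ‖z‖) ^ (2 * (d : ℝ) / r)) := by ring
    _ = _ := by rw [← rpow_add (by positivity), neg_div, neg_add_cancel, rpow_zero, mul_one]
end
end

section
/- Let d ≥ 1 and let F ∈ L¹_loc(ℂ^d). (1) If ∫_{ℂ^d} |F(w)| e^{N|w| − |w|²} dλ(w) < ∞ for every N ≥ 0, then the integral defining (Π_A F)(z) converges absolutely for every z ∈ ℂ^d and Π_A F is an entire function on ℂ^d. (2) If p ∈ (0,∞], F is entire, and ‖F · e^{N|·| − |·|²}‖_{L^p(ℂ^d)} < ∞ for every N ≥ 0, then Π_A F = F. -/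
open MeasureTheory Filter
open scoped ENNReal

noncomputable section

/-- The pairing `(z,w) = ∑ z_j conj(w_j)`. -/
def pairB {d : ℕ} (z w : CSp d) : ℂ := ∑ j, z j * (starRingEnd ℂ) (w j)

/-- The density of the Gaussian measure `dμ = π^{−d} e^{−|z|²} dλ`. -/
def gaussW (d : ℕ) (w : CSp d) : ℝ := (Real.pi ^ d)⁻¹ * Real.exp (-‖w‖ ^ 2)

/-- The Bargmann projection `(Π_A F)(z) = ∫ F(w) e^{(z,w)} dμ(w)`. -/
def PiA (d : ℕ) (F : CSp d → ℂ) (z : CSp d) : ℂ :=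
  ∫ w : CSp d, F w * Complex.exp (pairB z w) * Complex.ofReal (gaussW d w)

lemma pairB_eq_inner {d : ℕ} (z w : CSp d) : pairB z w = inner ℂ w z := by
  simp [pairB, PiLp.inner_apply]

lemma norm_exp_pairB_le {d : ℕ} (z w : CSp d) :
    ‖Complex.exp (pairB z w)‖ ≤ Real.exp (‖z‖ * ‖w‖) := by
  rw [Complex.norm_exp, Real.exp_le_exp, pairB_eq_inner, mul_comm]
  exact (Complex.re_le_norm _).trans (norm_inner_le_norm _ _)

lemma continuous_pairB {d : ℕ} (z : CSp d) : Continuous (fun w : CSp d => pairB z w) := by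
  simp only [pairB_eq_inner]
  fun_prop

lemma continuous_gaussW (d : ℕ) : Continuous (gaussW d) := by
  unfold gaussW
  fun_prop

lemma gaussW_nonneg (d : ℕ) (w : CSp d) : 0 ≤ gaussW d w := by
  unfold gaussW
  positivity

/-- The Bargmann integrand is dominated by `|F(w)| e^{N|w| - |w|²}` as soon as `|z| ≤ N`. -/
lemma norm_bargmann_integrand_le {d : ℕ} (F : CSp d → ℂ) {z : CSp d} {N : ℝ} (hz : ‖z‖ ≤ N)
    (w : CSp d) :
    ‖F w * Complex.exp (pairB z w) * Complex.ofReal (gaussW d w)‖ ≤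
      (Real.pi ^ d)⁻¹ * (‖F w‖ * Real.exp (N * ‖w‖ - ‖w‖ ^ 2)) := by
  have h : ‖Complex.exp (pairB z w)‖ ≤ Real.exp (N * ‖w‖) :=
    (norm_exp_pairB_le z w).trans (by gcongr)
  rw [norm_mul, norm_mul, Complex.norm_real, Real.norm_of_nonneg (gaussW_nonneg d w), gaussW]
  calc ‖F w‖ * ‖Complex.exp (pairB z w)‖ * ((Real.pi ^ d)⁻¹ * Real.exp (-‖w‖ ^ 2))
      ≤ ‖F w‖ * Real.exp (N * ‖w‖) * ((Real.pi ^ d)⁻¹ * Real.exp (-‖w‖ ^ 2)) := by gcongr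
    _ = (Real.pi ^ d)⁻¹ * (‖F w‖ * (Real.exp (N * ‖w‖) * Real.exp (-‖w‖ ^ 2))) := by ring
    _ = _ := by rw [← Real.exp_add, ← sub_eq_add_neg]

lemma aestronglyMeasurable_bargmann_integrand {d : ℕ} {F : CSp d → ℂ}
    (hF : AEStronglyMeasurable F volume) (z : CSp d) :
    AEStronglyMeasurable
      (fun w => F w * Complex.exp (pairB z w) * Complex.ofReal (gaussW d w)) volume := by
  have h := continuous_pairB z
  have h' := continuous_gaussW d
  refine (hF.mul ?_).mul ?_ <;> exact Continuous.aestronglyMeasurable (by fun_prop)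

lemma integrable_bargmann_integrand {d : ℕ} {F : CSp d → ℂ}
    (hF : AEStronglyMeasurable F volume)
    (hint : ∀ N : ℝ, 0 ≤ N →
      Integrable (fun w : CSp d => ‖F w‖ * Real.exp (N * ‖w‖ - ‖w‖ ^ 2)) volume) (z : CSp d) :
    Integrable (fun w => F w * Complex.exp (pairB z w) * Complex.ofReal (gaussW d w)) volume :=
  ((hint ‖z‖ (norm_nonneg z)).const_mul _).mono' (aestronglyMeasurable_bargmann_integrand hF z)
    (.of_forall (norm_bargmann_integrand_le F le_rfl))

lemma differentiable_PiA {d : ℕ} {F : CSp d → ℂ} (hF : AEStronglyMeasurable F volume)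
    (hint : ∀ N : ℝ, 0 ≤ N →
      Integrable (fun w : CSp d => ‖F w‖ * Real.exp (N * ‖w‖ - ‖w‖ ^ 2)) volume) :
    Differentiable ℂ (PiA d F) := by
  intro z₀
  have key := hasFDerivAt_integral_of_dominated_of_fderiv_le (𝕜 := ℂ) (μ := volume)
    (F := fun (z w : CSp d) => F w * Complex.exp (pairB z w) * Complex.ofReal (gaussW d w))
    (F' := fun (z w : CSp d) =>
      (F w * Complex.exp (pairB z w) * Complex.ofReal (gaussW d w)) • innerSL ℂ w)
    (x₀ := z₀) (s := Metric.ball z₀ 1)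
    (bound := fun w => (Real.pi ^ d)⁻¹ * (‖F w‖ * Real.exp ((‖z₀‖ + 2) * ‖w‖ - ‖w‖ ^ 2)))
    (Metric.ball_mem_nhds z₀ one_pos)
    (.of_forall fun z => aestronglyMeasurable_bargmann_integrand hF z)
    (integrable_bargmann_integrand hF hint z₀)
    ((aestronglyMeasurable_bargmann_integrand hF z₀).smul
      (innerSL ℂ (E := CSp d)).continuous.aestronglyMeasurable)
    (.of_forall fun w z hz => ?_) ((hint _ (by positivity)).const_mul _)
    (.of_forall fun w z _ => ?_)
  · exact key.differentiableAt
  · have hz' : ‖z‖ ≤ ‖z₀‖ + 1 := by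
      have h := norm_sub_norm_le z z₀
      rw [mem_ball_iff_norm] at hz
      linarith
    rw [norm_smul, innerSL_apply_norm]
    calc _ ≤ (Real.pi ^ d)⁻¹ * (‖F w‖ * Real.exp ((‖z₀‖ + 1) * ‖w‖ - ‖w‖ ^ 2)) *
          Real.exp ‖w‖ := by
          gcongr
          · exact norm_bargmann_integrand_le F hz' w
          · linarith [Real.add_one_le_exp ‖w‖]
      _ = (Real.pi ^ d)⁻¹ * (‖F w‖ * (Real.exp ((‖z₀‖ + 1) * ‖w‖ - ‖w‖ ^ 2) *
          Real.exp ‖w‖)) := by ring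
      _ = _ := by
        rw [← Real.exp_add]
        ring_nf
  · have h : HasFDerivAt (fun z : CSp d => pairB z w) (innerSL ℂ w) z := by
      simp only [pairB_eq_inner]
      exact (innerSL ℂ w).hasFDerivAt
    convert! (h.cexp.const_mul (F w)).mul_const (Complex.ofReal (gaussW d w)) using 1
    simp only [smul_smul]
    ring_nf

/-- Multiplication by a unimodular scalar preserves Lebesgue measure on `ℂ^d`. -/
lemma measurePreserving_circle_smul {d : ℕ} (c : ℂ) (hc : ‖c‖ = 1) :
    MeasurePreserving (fun w : CSp d => c • w) volume volume := by
  have hc0 : c ≠ 0 := norm_ne_zero_iff.1 (by simp [hc])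
  let e : CSp d ≃ₗᵢ[ℝ] CSp d :=
    { (LinearEquiv.smulOfNeZero ℂ (CSp d) c hc0).restrictScalars ℝ with
      norm_map' := fun w => by
        change ‖c • w‖ = ‖w‖
        rw [norm_smul, hc, one_mul] }
  exact e.measurePreserving

/-- The mean value property of entire functions with respect to circularly symmetric weights. -/
lemma integral_mul_of_circle_invariant {d : ℕ} {H ρ : CSp d → ℂ} (hH : Differentiable ℂ H)
    (hρm : Measurable ρ) (hρ : ∀ (c : ℂ) (u : CSp d), ‖c‖ = 1 → ρ (c • u) = ρ u)
    (hint : Integrable (fun u => H u * ρ u) volume) :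
    ∫ u, H u * ρ u = H 0 * ∫ u, ρ u := by
  have hnorm (θ : ℝ) : ‖circleMap 0 1 θ‖ = 1 := by simp
  have hrot (θ : ℝ) : MeasurePreserving (fun u : CSp d => circleMap 0 1 θ • u) volume volume :=
    measurePreserving_circle_smul _ (hnorm θ)
  have hemb (θ : ℝ) : MeasurableEmbedding (fun u : CSp d => circleMap 0 1 θ • u) :=
    (Homeomorph.smulOfNeZero (circleMap 0 1 θ) (norm_ne_zero_iff.1 (by simp))).measurableEmbedding
  have hintθ (θ : ℝ) : Integrable (fun u => H (circleMap 0 1 θ • u) * ρ u) volume := by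
    refine ((hrot θ).integrable_comp_of_integrable hint).congr (.of_forall fun u => ?_)
    simp [hρ _ u (hnorm θ)]
  have hcongr (θ : ℝ) : ∫ u, H (circleMap 0 1 θ • u) * ρ u = ∫ u, H u * ρ u := by
    rw [← (hrot θ).integral_comp (hemb θ) (fun u => H u * ρ u)]
    simp [fun u => hρ _ u (hnorm θ)]
  have hcongr' (θ : ℝ) : ∫ u, ‖H (circleMap 0 1 θ • u) * ρ u‖ = ∫ u, ‖H u * ρ u‖ := by
    rw [← (hrot θ).integral_comp (hemb θ) (fun u => ‖H u * ρ u‖)]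
    simp [fun u => hρ _ u (hnorm θ)]
  have hmean (u : CSp d) : ∫ θ in (0 : ℝ)..2 * Real.pi, H (circleMap 0 1 θ • u) =
      2 * Real.pi * H 0 := by
    have h : Differentiable ℂ (fun c : ℂ => H (c • u)) := by fun_prop
    have h' := DiffContOnCl.circleAverage (R := 1) (c := 0) (h.diffContOnCl (s := _))
    rw [Real.circleAverage_def, zero_smul, inv_smul_eq_iff₀ (by positivity)] at h'
    rw [h']
    simp
  have hprod : Integrable (Function.uncurry fun (θ : ℝ) u => H (circleMap 0 1 θ • u) * ρ u)
      ((volume.restrict (Set.uIoc 0 (2 * Real.pi))).prod volume) := by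
    have hc := hH.continuous
    have hm : AEStronglyMeasurable
        (Function.uncurry fun (θ : ℝ) u => H (circleMap 0 1 θ • u) * ρ u)
        ((volume.restrict (Set.uIoc 0 (2 * Real.pi))).prod volume) := by
      have h1 : Continuous (fun x : ℝ × CSp d => H (circleMap 0 1 x.1 • x.2)) := by fun_prop
      exact (h1.measurable.mul (hρm.comp measurable_snd)).aestronglyMeasurable
    rw [integrable_prod_iff hm]
    refine ⟨.of_forall hintθ, ?_⟩
    simp only [Function.uncurry_apply_pair, hcongr']
    have : IsFiniteMeasure (volume.restrict (Set.uIoc 0 (2 * Real.pi))) := ⟨by simp [Set.uIoc]⟩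
    exact integrable_const _
  have hswap := intervalIntegral_integral_swap hprod
  simp only [hcongr, intervalIntegral.integral_mul_const, hmean, integral_const_mul,
    intervalIntegral.integral_const, sub_zero] at hswap
  have hpi : (2 * Real.pi : ℂ) ≠ 0 := by simp [Real.pi_ne_zero]
  refine mul_left_cancel₀ hpi ?_
  rw [← mul_assoc, ← hswap, Complex.real_smul]
  simp

lemma setIntegral_closedBall_add {d : ℕ} {E : Type*} [NormedAddCommGroup E] [NormedSpace ℝ E]
    (f : CSp d → E) (w : CSp d) (r : ℝ) :
    ∫ u in Metric.closedBall 0 r, f (w + u) = ∫ v in Metric.closedBall w r, f v := by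
  rw [← integral_indicator measurableSet_closedBall, ← integral_indicator measurableSet_closedBall,
    ← integral_add_left_eq_self ((Metric.closedBall w r).indicator f) w]
  refine integral_congr_ae (.of_forall fun u => ?_)
  simp [Set.indicator, dist_eq_norm]

/-- The mean value inequality for entire functions on balls of `ℂ^d`. -/
lemma norm_mul_volume_closedBall_le {d : ℕ} {G : CSp d → ℂ} (hG : Differentiable ℂ G)
    (u : CSp d) (r : ℝ) :
    ‖G u‖ * volume.real (Metric.closedBall u r) ≤ ∫ v in Metric.closedBall u r, ‖G v‖ := by
  have hmul (v : CSp d) : G (u + v) * (Metric.closedBall (0 : CSp d) r).indicator (fun _ => (1 : ℂ)) v =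
      (Metric.closedBall (0 : CSp d) r).indicator (fun v => G (u + v)) v := by
    simp [Set.indicator]
  have hc : Continuous fun v => G (u + v) := hG.continuous.comp (by fun_prop)
  have key := integral_mul_of_circle_invariant (H := fun v => G (u + v))
    (ρ := (Metric.closedBall (0 : CSp d) r).indicator fun _ => (1 : ℂ)) (hG.comp (by fun_prop))
    (measurable_const.indicator measurableSet_closedBall)
    (fun c v hc => by simp [Set.indicator, norm_smul, hc]) (by
      simp only [hmul]
      exact (hc.continuousOn.integrableOn_compact (isCompact_closedBall 0 r)).integrable_indicator
        measurableSet_closedBall)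
  simp only [hmul] at key
  rw [integral_indicator measurableSet_closedBall, integral_indicator measurableSet_closedBall,
    setIntegral_const, setIntegral_closedBall_add, add_zero, ← Measure.addHaar_real_closedBall_center volume u,
    Complex.real_smul, mul_one] at key
  calc _ = ‖G u * (volume.real (Metric.closedBall u r) : ℂ)‖ := by
        rw [norm_mul, Complex.norm_real, Real.norm_of_nonneg measureReal_nonneg]
    _ ≤ _ := by
      rw [← key]
      exact norm_integral_le_integral_norm _

/-- The `L^q` mean value inequality for entire functions, `0 < q ≤ 1`. -/
lemma exists_norm_rpow_le_integral {d : ℕ} (hd : 1 ≤ d) {q : ℝ} (hq : 0 < q) (hq1 : q ≤ 1) :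
    ∃ C : ℝ, 0 ≤ C ∧ ∀ G : CSp d → ℂ, Differentiable ℂ G →
      ‖G 0‖ ^ q ≤ C * ∫ u in Metric.closedBall 0 1, ‖G u‖ ^ q := by
  set n := Module.finrank ℝ (CSp d) with hn
  have hn0 : 0 < n := by
    rw [hn, finrank_real_of_complex]
    simpa using Nat.pos_of_ne_zero (by lia)
  set V := volume.real (Metric.closedBall (0 : CSp d) 1) with hV
  have hV0 : 0 < V :=
    ENNReal.toReal_pos (Metric.measure_closedBall_pos _ _ one_pos).ne' measure_closedBall_lt_top.ne
  set m : ℝ := n / q with hm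
  have hm0 : 0 < m := by positivity
  refine ⟨2 ^ n * (2 ^ m) ^ (1 - q) / V, by positivity, fun G hG => ?_⟩
  have hGc := hG.continuous
  have hGq : Continuous fun u => ‖G u‖ ^ q := hGc.norm.rpow_const fun _ => .inr hq.le
  obtain ⟨u, hu, hmax⟩ := (isCompact_closedBall (0 : CSp d) 1).exists_isMaxOn
    (f := fun u => ‖G u‖ * (1 - ‖u‖) ^ m) ⟨0, by simp⟩
    ((hGc.norm.mul ((continuous_const.sub continuous_norm).rpow_const
      fun _ => .inr hm0.le)).continuousOn)
  have hmax' : ∀ v : CSp d, ‖v‖ ≤ 1 → ‖G v‖ * (1 - ‖v‖) ^ m ≤ ‖G u‖ * (1 - ‖u‖) ^ m :=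
    fun v hv => hmax (by simpa using hv)
  have hu1 : ‖u‖ ≤ 1 := by simpa using hu
  have h0 : ‖G 0‖ ≤ ‖G u‖ * (1 - ‖u‖) ^ m := by simpa using hmax' 0 (by simp)
  have hI0 : 0 ≤ ∫ u in Metric.closedBall (0 : CSp d) 1, ‖G u‖ ^ q :=
    integral_nonneg fun _ => by positivity
  rcases (norm_nonneg (G 0)).eq_or_lt with hz | hpos
  · rw [← hz, Real.zero_rpow hq.ne']
    positivity
  have hprod := hpos.trans_le h0
  have hlt : 0 < 1 - ‖u‖ := by
    refine (sub_nonneg.2 hu1).lt_of_ne fun h => ?_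
    rw [← h, Real.zero_rpow hm0.ne', mul_zero] at hprod
    exact hprod.false
  have ha : 0 < ‖G u‖ := pos_of_mul_pos_left hprod (by positivity)
  set a := ‖G u‖
  obtain ⟨r, hr⟩ : ∃ r, r = (1 - ‖u‖) / 2 := ⟨_, rfl⟩
  have hr0 : 0 < r := by linarith
  have hsub : Metric.closedBall u r ⊆ Metric.closedBall (0 : CSp d) 1 :=
    Metric.closedBall_subset_closedBall' (by rw [dist_zero_right]; linarith)
  have hloc : ∀ v ∈ Metric.closedBall u r, ‖G v‖ ≤ 2 ^ m * a := by
    intro v hv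
    have hv1 : ‖v‖ ≤ ‖u‖ + r := by
      have := norm_sub_norm_le v u
      rw [mem_closedBall_iff_norm] at hv
      linarith
    have h1 := hmax' v (by linarith)
    have h2 : r ^ m ≤ (1 - ‖v‖) ^ m := Real.rpow_le_rpow hr0.le (by linarith) hm0.le
    have h3 : (1 - ‖u‖) ^ m = 2 ^ m * r ^ m := by
      rw [← Real.mul_rpow (by norm_num) hr0.le, hr]
      congr 1
      ring
    have h4 : 0 < r ^ m := by positivity
    refine le_of_mul_le_mul_right ?_ h4
    calc ‖G v‖ * r ^ m ≤ ‖G v‖ * (1 - ‖v‖) ^ m := by gcongr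
      _ ≤ _ := h1
      _ = _ := by rw [h3]; ring
  have hmv : a * (r ^ n * V) ≤
      (2 ^ m * a) ^ (1 - q) * ∫ v in Metric.closedBall (0 : CSp d) 1, ‖G v‖ ^ q := by
    rw [hV, hn, ← Measure.addHaar_real_closedBall' volume u hr0.le]
    have hint := hGq.continuousOn.integrableOn_compact (μ := volume)
      (isCompact_closedBall (0 : CSp d) 1)
    calc _ ≤ ∫ v in Metric.closedBall u r, ‖G v‖ := norm_mul_volume_closedBall_le hG u r
      _ ≤ ∫ v in Metric.closedBall u r, (2 ^ m * a) ^ (1 - q) * ‖G v‖ ^ q := by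
        refine setIntegral_mono_on
          (hGc.norm.continuousOn.integrableOn_compact (isCompact_closedBall u r))
          ((hint.mono_set hsub).const_mul _) measurableSet_closedBall fun v hv => ?_
        calc ‖G v‖ = ‖G v‖ ^ (1 - q) * ‖G v‖ ^ q := by
              rw [← Real.rpow_add_of_nonneg (norm_nonneg _) (by linarith) hq.le]
              simp
          _ ≤ _ := by
            gcongr
            exact hloc v hv
      _ = (2 ^ m * a) ^ (1 - q) * ∫ v in Metric.closedBall u r, ‖G v‖ ^ q :=
        integral_const_mul _ _
      _ ≤ _ := by
        refine mul_le_mul_of_nonneg_left ?_ (by positivity)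
        exact setIntegral_mono_set hint (.of_forall fun _ => by positivity) hsub.eventuallyLE
  have haq : a = a ^ (1 - q) * a ^ q := by
    rw [← Real.rpow_add ha]
    simp
  have hmain : a ^ q * r ^ n * V ≤
      (2 ^ m) ^ (1 - q) * ∫ v in Metric.closedBall (0 : CSp d) 1, ‖G v‖ ^ q := by
    have ha' : 0 < a ^ (1 - q) := by positivity
    refine le_of_mul_le_mul_left ?_ ha'
    rw [Real.mul_rpow (by positivity) ha.le] at hmv
    calc _ = (a ^ (1 - q) * a ^ q) * (r ^ n * V) := by ring
      _ = a * (r ^ n * V) := by rw [← haq]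
      _ ≤ _ := hmv
      _ = _ := by ring
  calc ‖G 0‖ ^ q ≤ (a * (1 - ‖u‖) ^ m) ^ q := by gcongr
    _ = a ^ q * (2 * r) ^ n := by
      rw [Real.mul_rpow ha.le (by positivity), ← Real.rpow_mul hlt.le, hm,
        div_mul_cancel₀ _ hq.ne', Real.rpow_natCast, hr]
      ring_nf
    _ = 2 ^ n / V * (a ^ q * r ^ n * V) := by
      field_simp
      ring
    _ ≤ 2 ^ n / V *
        ((2 ^ m) ^ (1 - q) * ∫ v in Metric.closedBall (0 : CSp d) 1, ‖G v‖ ^ q) := by gcongr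
    _ = _ := by ring

/-- The weighted function `F e^{N|·| - |·|²}` is bounded if `F` is entire and the weighted function
is in some `L^p`, `0 < p ≤ ∞`. -/
lemma exists_norm_mul_exp_le {d : ℕ} (hd : 1 ≤ d) {F : CSp d → ℂ} (hF : Differentiable ℂ F)
    {p : ℝ≥0∞} (hp : 0 < p) {N : ℝ} (hN : 0 ≤ N)
    (hLp : eLpNorm (fun w : CSp d => F w * Complex.ofReal (Real.exp (N * ‖w‖ - ‖w‖ ^ 2)))
      p volume < ⊤) :
    ∃ C : ℝ, ∀ w, ‖F w‖ * Real.exp (N * ‖w‖ - ‖w‖ ^ 2) ≤ C := by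
  set Φ : CSp d → ℂ := fun w => F w * Complex.ofReal (Real.exp (N * ‖w‖ - ‖w‖ ^ 2)) with hΦ
  have hFc := hF.continuous
  have hΦc : Continuous Φ := by fun_prop
  have hΦn (w : CSp d) : ‖Φ w‖ = ‖F w‖ * Real.exp (N * ‖w‖ - ‖w‖ ^ 2) := by
    rw [hΦ, norm_mul, Complex.norm_real, Real.norm_of_nonneg (Real.exp_nonneg _)]
  set q : ℝ≥0∞ := min p 1
  have hq0 : q ≠ 0 := (lt_min hp one_pos).ne'
  have hqt : q ≠ ⊤ := ((min_le_right p 1).trans_lt ENNReal.one_lt_top).ne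
  have hs0 : 0 < q.toReal := ENNReal.toReal_pos hq0 hqt
  have hs1 : q.toReal ≤ 1 := by
    simpa using ENNReal.toReal_mono ENNReal.one_ne_top (min_le_right p 1)
  set s := q.toReal
  obtain ⟨C, hC0, hC⟩ := exists_norm_rpow_le_integral hd hs0 hs1
  obtain ⟨K, hK0, hK⟩ : ∃ K : ℝ, 0 ≤ K ∧ ∀ w : CSp d,
      ∫ v in Metric.closedBall w 1, ‖Φ v‖ ^ s ≤ K ^ s := by
    set V := volume (Metric.closedBall (0 : CSp d) 1) ^ (1 / q.toReal - 1 / p.toReal)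
    have hV : V ≠ ⊤ := by
      simp [V, ENNReal.rpow_eq_top_iff, (Metric.measure_closedBall_pos volume (0 : CSp d)
        one_pos).ne', (measure_closedBall_lt_top (μ := volume) (x := (0 : CSp d)) (r := 1)).ne]
    have hKt := ENNReal.mul_ne_top hLp.ne hV
    refine ⟨(eLpNorm Φ p volume * V).toReal, ENNReal.toReal_nonneg, fun w => ?_⟩
    have hle : eLpNorm Φ q (volume.restrict (Metric.closedBall w 1)) ≤ eLpNorm Φ p volume * V := by
      refine (eLpNorm_le_eLpNorm_mul_rpow_measure_univ (min_le_left p 1)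
        hΦc.aestronglyMeasurable).trans ?_
      rw [Measure.restrict_apply_univ, Measure.addHaar_closedBall_center]
      exact mul_le_mul_left (eLpNorm_mono_measure _ Measure.restrict_le_self) _
    have hmem : MemLp Φ q (volume.restrict (Metric.closedBall w 1)) :=
      ⟨hΦc.aestronglyMeasurable, hle.trans_lt hKt.lt_top⟩
    rw [hmem.eLpNorm_eq_integral_rpow_norm hq0 hqt] at hle
    have h := (ENNReal.ofReal_le_iff_le_toReal hKt).1 hle
    rwa [Real.rpow_inv_le_iff_of_pos (integral_nonneg fun _ => by positivity)
      ENNReal.toReal_nonneg hs0] at h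
  refine ⟨C ^ s⁻¹ * (Real.exp (1 + N) * K), fun w => ?_⟩
  set E := Real.exp (1 + N + ‖w‖ ^ 2 - N * ‖w‖) with hE
  have hpw (u : CSp d) (hu : u ∈ Metric.closedBall (0 : CSp d) 1) :
      ‖F (w + u) * Complex.exp (-2 * pairB u w)‖ ≤ E * ‖Φ (w + u)‖ := by
    have hu1 : ‖u‖ ≤ 1 := by simpa using hu
    have hsq : ‖w + u‖ ^ 2 = ‖w‖ ^ 2 + 2 * (pairB u w).re + ‖u‖ ^ 2 := by
      rw [pairB_eq_inner]
      exact norm_add_sq (𝕜 := ℂ) w u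
    have hw : ‖w‖ ≤ ‖w + u‖ + 1 := by
      have := norm_sub_le (w + u) u
      rw [add_sub_cancel_right] at this
      linarith
    rw [hΦn, norm_mul, mul_left_comm, hE, ← Real.exp_add, Complex.norm_exp]
    gcongr
    have h1 : (-2 * pairB u w).re = -2 * (pairB u w).re := by simp
    rw [h1]
    nlinarith [norm_nonneg u]
  have hGd : Differentiable ℂ (fun u => F (w + u) * Complex.exp (-2 * pairB u w)) := by
    have h : Differentiable ℂ (fun u : CSp d => pairB u w) := by
      simp only [pairB_eq_inner]
      exact (innerSL ℂ w).differentiable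
    fun_prop
  have hint : ∫ u in Metric.closedBall 0 1, ‖F (w + u) * Complex.exp (-2 * pairB u w)‖ ^ s ≤
      (E * K) ^ s := by
    calc _ ≤ ∫ u in Metric.closedBall 0 1, E ^ s * ‖Φ (w + u)‖ ^ s := by
          have hΦw : Continuous fun u => E ^ s * ‖Φ (w + u)‖ ^ s :=
            continuous_const.mul ((hΦc.comp (by fun_prop)).norm.rpow_const fun _ => .inr hs0.le)
          refine setIntegral_mono_on
            ((hGd.continuous.norm.rpow_const fun _ => .inr hs0.le).continuousOn.integrableOn_compact
              (isCompact_closedBall _ _))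
            (hΦw.continuousOn.integrableOn_compact (isCompact_closedBall _ _))
            measurableSet_closedBall fun u hu => ?_
          rw [← Real.mul_rpow (Real.exp_nonneg _) (norm_nonneg _)]
          gcongr
          exact hpw u hu
      _ = E ^ s * ∫ v in Metric.closedBall w 1, ‖Φ v‖ ^ s := by
        rw [integral_const_mul, setIntegral_closedBall_add (fun v => ‖Φ v‖ ^ s)]
      _ ≤ E ^ s * K ^ s := by
        gcongr
        exact hK w
      _ = _ := (Real.mul_rpow (Real.exp_nonneg _) hK0).symm
  have hEK : 0 ≤ E * K := by positivity
  have hFw : ‖F w‖ ≤ C ^ s⁻¹ * (E * K) := by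
    have h := (hC _ hGd).trans (mul_le_mul_of_nonneg_left hint hC0)
    simp only [pairB_eq_inner, add_zero, inner_zero_right, mul_zero, Complex.exp_zero,
      mul_one] at h
    rw [← Real.rpow_le_rpow_iff (norm_nonneg _) (by positivity) hs0,
      Real.mul_rpow (by positivity) hEK, Real.rpow_inv_rpow hC0 hs0.ne']
    exact h
  calc _ ≤ C ^ s⁻¹ * (E * K) * Real.exp (N * ‖w‖ - ‖w‖ ^ 2) := by gcongr
    _ = C ^ s⁻¹ * (E * Real.exp (N * ‖w‖ - ‖w‖ ^ 2) * K) := by ring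
    _ = _ := by
      rw [hE, ← Real.exp_add]
      ring_nf

lemma integrable_exp_neg_norm (d : ℕ) :
    Integrable (fun w : CSp d => Real.exp (-‖w‖)) volume := by
  set k := Module.finrank ℝ (CSp d) + 1 with hk
  have hJ : Integrable (fun w : CSp d => (1 + ‖w‖) ^ (-(k : ℝ))) volume :=
    integrable_one_add_norm (by simp [hk])
  refine (hJ.const_mul (Real.exp 1 * k.factorial)).mono'
    (Continuous.aestronglyMeasurable (by fun_prop)) (.of_forall fun w => ?_)
  have h := Real.pow_div_factorial_le_exp (1 + ‖w‖) (by positivity) k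
  rw [Real.norm_of_nonneg (Real.exp_nonneg _), Real.exp_neg, Real.rpow_neg (by positivity),
    Real.rpow_natCast, ← div_eq_mul_inv, le_div_iff₀ (by positivity),
    inv_mul_le_iff₀ (Real.exp_pos _)]
  rw [div_le_iff₀ (by positivity), Real.exp_add] at h
  linarith

lemma integral_exp_neg_norm_sq (d : ℕ) :
    ∫ u : CSp d, Real.exp (-‖u‖ ^ 2) = Real.pi ^ d := by
  have h := GaussianFourier.integral_rexp_neg_mul_sq_norm (V := CSp d) one_pos
  rw [finrank_real_of_complex] at h
  simpa using h

/-- The reproducing property of the Bargmann kernel. -/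
lemma PiA_eq_self {d : ℕ} {F : CSp d → ℂ} (hF : Differentiable ℂ F)
    (hint : ∀ z : CSp d, Integrable
      (fun w => F w * Complex.exp (pairB z w) * Complex.ofReal (gaussW d w)) volume) :
    PiA d F = F := by
  funext z
  have hshift (u : CSp d) : F (z + u) * Complex.exp (pairB z (z + u)) *
      Complex.ofReal (gaussW d (z + u)) =
        F (z + u) * Complex.exp (-pairB u z) * Complex.ofReal (gaussW d u) := by
    have hpair : pairB z (z + u) - (‖z + u‖ ^ 2 : ℝ) = -pairB u z - (‖u‖ ^ 2 : ℝ) := by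
      have h (v : CSp d) : ((‖v‖ ^ 2 : ℝ) : ℂ) = inner ℂ v v := by
        rw [inner_self_eq_norm_sq_to_K]
        simp
      simp only [h, pairB_eq_inner, inner_add_left, inner_add_right]
      ring
    simp only [gaussW, Complex.ofReal_mul, Complex.ofReal_exp, Complex.ofReal_neg]
    rw [mul_assoc, mul_assoc, mul_left_comm (Complex.exp _), mul_left_comm (Complex.exp _),
      ← Complex.exp_add, ← Complex.exp_add, ← sub_eq_add_neg, ← sub_eq_add_neg, hpair]
  have hd : Differentiable ℂ (fun u => F (z + u) * Complex.exp (-pairB u z)) := by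
    have h : Differentiable ℂ (fun u : CSp d => pairB u z) := by
      simp only [pairB_eq_inner]
      exact (innerSL ℂ z).differentiable
    fun_prop
  have key := integral_mul_of_circle_invariant hd
    (ρ := fun u => Complex.ofReal (gaussW d u))
    (Complex.measurable_ofReal.comp (continuous_gaussW d).measurable)
    (fun c u hc => by simp [gaussW, norm_smul, hc])
    (by simpa only [hshift] using (hint z).comp_add_left z)
  simp only [← hshift] at key
  rw [integral_add_left_eq_self
    (fun w => F w * Complex.exp (pairB z w) * Complex.ofReal (gaussW d w)) z] at key
  rw [PiA, key, integral_complex_ofReal]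
  simp [gaussW, pairB_eq_inner, integral_const_mul, integral_exp_neg_norm_sq, Real.pi_ne_zero]

/-- (1) if `F ∈ L¹_loc(ℂ^d)` and `∫ |F(w)| e^{N|w|−|w|²} dλ(w) < ∞` for every
`N ≥ 0`, then the integral defining `Π_A F` converges absolutely at every point and `Π_A F`
is entire; (2) if moreover `F` is entire and `‖F e^{N|·|−|·|²}‖_{L^p} < ∞` for every `N ≥ 0`
and some `p ∈ (0,∞]`, then `Π_A F = F`. -/
theorem stmt5 (d : ℕ) (hd : 1 ≤ d) (F : CSp d → ℂ) (hF : LocallyIntegrable F volume) :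
    ((∀ N : ℝ, 0 ≤ N →
        Integrable (fun w : CSp d => ‖F w‖ * Real.exp (N * ‖w‖ - ‖w‖ ^ 2)) volume) →
      (∀ z : CSp d, Integrable
        (fun w => F w * Complex.exp (pairB z w) * Complex.ofReal (gaussW d w)) volume) ∧
      Differentiable ℂ (PiA d F))
    ∧
    (∀ p : ℝ≥0∞, 0 < p → Differentiable ℂ F →
      (∀ N : ℝ, 0 ≤ N →
        eLpNorm (fun w : CSp d => F w * Complex.ofReal (Real.exp (N * ‖w‖ - ‖w‖ ^ 2)))
          p volume < ⊤) →
      PiA d F = F) := by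
  have hFm := hF.aestronglyMeasurable
  refine ⟨fun h => ⟨integrable_bargmann_integrand hFm h, differentiable_PiA hFm h⟩,
    fun p hp hFd hLp => PiA_eq_self hFd (integrable_bargmann_integrand hFm fun N hN => ?_)⟩
  obtain ⟨C, hC⟩ := exists_norm_mul_exp_le hd hFd hp (add_nonneg hN zero_le_one)
    (hLp (N + 1) (by positivity))
  refine ((integrable_exp_neg_norm d).const_mul C).mono'
    (hFm.norm.mul (Continuous.aestronglyMeasurable (by fun_prop))) (.of_forall fun w => ?_)
  rw [Real.norm_of_nonneg (by positivity)]
  calc _ = ‖F w‖ * Real.exp ((N + 1) * ‖w‖ - ‖w‖ ^ 2) * Real.exp (-‖w‖) := by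
        rw [mul_assoc, ← Real.exp_add]
        ring_nf
    _ ≤ _ := by
      gcongr
      exact hC w
end
end

section
/- Let d ≥ 1, c, C₁, C₂ > 0, and let ω, ω₁ : ℝ^d → (0,∞) be measurable with C₁⁻¹ ω(x) ≤ ω(x+y) ≤ C₁ ω(x) whenever |x| ≥ 2c and |y| ≤ c/|x|, and ω₁(x) ≤ C₂ (1+|x|)^{−d} ω(x) for all x. Let f : ℝ^d → ℂ be continuous, satisfy the mean value property (for every x ∈ ℝ^d and every ρ > 0, f(x) equals the average of f over the ball of radius ρ centered at x), and satisfy ∫_{ℝ^d} |f(x)| ω(x) dx < ∞. Then there is a constant C₃ > 0, depending only on d, c, C₁, C₂, such that |f(x)| ω₁(x) ≤ C₃ ∫_{ℝ^d} |f(y)| ω(y) dy for all x with |x| ≥ 2c. -/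
open MeasureTheory Filter
open scoped ENNReal

noncomputable section

/-- `ℝ^d` with the Euclidean norm and Lebesgue measure. -/
abbrev RSp (d : ℕ) := EuclideanSpace ℝ (Fin d)

/-- a pointwise estimate for functions with the mean value property, with a
constant depending only on `d, c, C₁, C₂`. -/
theorem stmt10 (d : ℕ) (hd : 1 ≤ d) (c C₁ C₂ : ℝ)
    (hc : 0 < c) (hC₁ : 0 < C₁) (hC₂ : 0 < C₂) :
    ∃ C₃ : ℝ, 0 < C₃ ∧
      ∀ ω ω₁ : RSp d → ℝ, Measurable ω → (∀ x, 0 < ω x) → (∀ x, 0 < ω₁ x) →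
        (∀ x y : RSp d, 2 * c ≤ ‖x‖ → ‖y‖ ≤ c / ‖x‖ →
          ω x / C₁ ≤ ω (x + y) ∧ ω (x + y) ≤ C₁ * ω x) →
        (∀ x : RSp d, ω₁ x ≤ C₂ * (1 + ‖x‖) ^ (-(d : ℝ)) * ω x) →
        ∀ f : RSp d → ℂ, Continuous f →
          (∀ (x : RSp d) (ρ : ℝ), 0 < ρ →
            f x = (volume (Metric.ball x ρ)).toReal⁻¹ • ∫ y in Metric.ball x ρ, f y) →
          Integrable (fun x : RSp d => ‖f x‖ * ω x) volume →
          ∀ x : RSp d, 2 * c ≤ ‖x‖ →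
            ‖f x‖ * ω₁ x ≤ C₃ * ∫ y : RSp d, ‖f y‖ * ω y := by
  set V : ℝ := (volume (Metric.ball (0 : RSp d) 1)).toReal
  have hVpos : 0 < V := ENNReal.toReal_pos
    (Metric.measure_ball_pos volume _ one_pos).ne' measure_ball_lt_top.ne
  refine ⟨C₂ * C₁ / (c ^ d * V), by positivity, ?_⟩
  intro ω ω₁ _ hω _ hωC hω₁C f hf hmean hint x hx
  have hxpos : 0 < ‖x‖ := by linarith
  set ρ : ℝ := c / ‖x‖ with hρ
  have hρpos : 0 < ρ := by positivity
  set I : ℝ := ∫ y : RSp d, ‖f y‖ * ω y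
  have hI0 : 0 ≤ I := integral_nonneg fun y => mul_nonneg (norm_nonneg _) (hω y).le
  have hvol : (volume (Metric.ball x ρ)).toReal = ρ ^ d * V := by
    rw [Measure.addHaar_ball_of_pos volume x hρpos, ENNReal.toReal_mul,
      ENNReal.toReal_ofReal (by positivity), finrank_euclideanSpace_fin]
  have hball : (∫ y in Metric.ball x ρ, ‖f y‖) * ω x ≤ C₁ * I := by
    rw [← integral_mul_const]
    calc ∫ y in Metric.ball x ρ, ‖f y‖ * ω x
        ≤ ∫ y in Metric.ball x ρ, C₁ * (‖f y‖ * ω y) := by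
          refine setIntegral_mono_on ?_ (hint.const_mul C₁).integrableOn
            Metric.isOpen_ball.measurableSet fun y hy => ?_
          · exact ((hf.norm.mul continuous_const).continuousOn.integrableOn_compact
              (isCompact_closedBall x ρ)).mono_set Metric.ball_subset_closedBall
          · have h := (hωC x (y - x) hx (mem_ball_iff_norm.mp hy).le).1
            rw [add_sub_cancel, div_le_iff₀ hC₁] at h
            calc ‖f y‖ * ω x ≤ ‖f y‖ * (ω y * C₁) := by gcongr
              _ = C₁ * (‖f y‖ * ω y) := by ring
      _ ≤ ∫ y, C₁ * (‖f y‖ * ω y) :=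
          setIntegral_le_integral (hint.const_mul C₁) (Eventually.of_forall fun y =>
            mul_nonneg hC₁.le (mul_nonneg (norm_nonneg _) (hω y).le))
      _ = C₁ * I := integral_const_mul _ _
  have hfx : ‖f x‖ ≤ (ρ ^ d * V)⁻¹ * ∫ y in Metric.ball x ρ, ‖f y‖ := by
    conv_lhs => rw [hmean x ρ hρpos]
    rw [norm_smul, hvol, Real.norm_of_nonneg (by positivity)]
    gcongr
    exact norm_integral_le_integral_norm _
  have hfω : ‖f x‖ * ω x ≤ (ρ ^ d * V)⁻¹ * (C₁ * I) :=
    calc ‖f x‖ * ω x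
        ≤ (ρ ^ d * V)⁻¹ * (∫ y in Metric.ball x ρ, ‖f y‖) * ω x :=
          mul_le_mul_of_nonneg_right hfx (hω x).le
      _ = (ρ ^ d * V)⁻¹ * ((∫ y in Metric.ball x ρ, ‖f y‖) * ω x) := mul_assoc _ _ _
      _ ≤ (ρ ^ d * V)⁻¹ * (C₁ * I) := by gcongr
  have hdecay : (1 + ‖x‖) ^ (-(d : ℝ)) ≤ (‖x‖ ^ d)⁻¹ := by
    rw [Real.rpow_neg (by positivity), Real.rpow_natCast]
    gcongr
    linarith
  calc ‖f x‖ * ω₁ x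
      ≤ ‖f x‖ * (C₂ * (‖x‖ ^ d)⁻¹ * ω x) := by
        refine mul_le_mul_of_nonneg_left ((hω₁C x).trans ?_) (norm_nonneg _)
        exact mul_le_mul_of_nonneg_right (mul_le_mul_of_nonneg_left hdecay hC₂.le) (hω x).le
    _ = C₂ * (‖x‖ ^ d)⁻¹ * (‖f x‖ * ω x) := by ring
    _ ≤ C₂ * (‖x‖ ^ d)⁻¹ * ((ρ ^ d * V)⁻¹ * (C₁ * I)) := by gcongr
    _ = C₂ * C₁ / (c ^ d * V) * I := by
        rw [hρ, div_pow]
        field_simp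
end
end

section
/- Let d ≥ 1 and let ω : ℝ^d → (0,∞) be measurable and of exponential type, i.e., there are constants c₀, C₀ > 0 with ω(x+y) ≤ C₀ ω(x) e^{c₀|y|} for all x, y ∈ ℝ^d. Then there exists a smooth function ω₀ : ℝ^d → (0,∞) and a constant C > 0 such that: (a) C⁻¹ ω₀(x) ≤ ω(x) ≤ C ω₀(x) for all x; (b) ω₀ is of exponential type (ω₀(x+y) ≤ C₁ ω₀(x) e^{c₀|y|} for some C₁ > 0); and (c) for every multi-index α there is a constant C_α > 0 with |∂^α ω₀(x)| ≤ C_α ω₀(x) for all x, i.e., ω₀ is elliptic. -/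
open MeasureTheory Filter
open scoped ENNReal

noncomputable section

open scoped Convolution

/-- A measurable function of exponential type is locally integrable. -/
lemma locallyIntegrable_of_exponentialType {d : ℕ} {c₀ C₀ : ℝ} {ω : RSp d → ℝ}
    (hωpos : ∀ x, 0 < ω x) (hωmeas : Measurable ω)
    (hmod : ∀ x y : RSp d, ω (x + y) ≤ C₀ * ω x * Real.exp (c₀ * ‖y‖)) :
    LocallyIntegrable ω := by
  have hcont : Continuous fun y : RSp d => C₀ * ω 0 * Real.exp (c₀ * ‖y‖) := by fun_prop
  refine hcont.locallyIntegrable.mono hωmeas.aestronglyMeasurable (Eventually.of_forall fun y => ?_)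
  have h := hmod 0 y
  rw [zero_add] at h
  rw [Real.norm_of_nonneg (hωpos y).le]
  exact h.trans (le_abs_self _)

/-- Values of a weight of exponential type at points of distance at most `R` are comparable. -/
lemma le_of_exponentialType_of_norm_sub_le {d : ℕ} {c₀ C₀ : ℝ} (hc₀ : 0 < c₀) (hC₀ : 0 < C₀)
    {ω : RSp d → ℝ} (hωpos : ∀ x, 0 < ω x)
    (hmod : ∀ x y : RSp d, ω (x + y) ≤ C₀ * ω x * Real.exp (c₀ * ‖y‖))
    {R : ℝ} {x t : RSp d} (h : ‖t - x‖ ≤ R) :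
    ω t ≤ C₀ * Real.exp (c₀ * R) * ω x := by
  have hx := hωpos x
  calc ω t = ω (x + (t - x)) := by rw [add_sub_cancel]
    _ ≤ C₀ * ω x * Real.exp (c₀ * ‖t - x‖) := hmod _ _
    _ ≤ C₀ * ω x * Real.exp (c₀ * R) := by gcongr
    _ = C₀ * Real.exp (c₀ * R) * ω x := by ring

/-- Convolving a weight of exponential type with a compactly supported continuous function yields
a function dominated by the weight. -/
lemma exists_norm_convolution_le_of_exponentialType {d : ℕ} {c₀ C₀ : ℝ} (hc₀ : 0 < c₀)
    (hC₀ : 0 < C₀) {ω : RSp d → ℝ} (hωpos : ∀ x, 0 < ω x)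
    (hmod : ∀ x y : RSp d, ω (x + y) ≤ C₀ * ω x * Real.exp (c₀ * ‖y‖))
    {F : Type*} [NormedAddCommGroup F] [NormedSpace ℝ F] {g : RSp d → F}
    (hg : Continuous g) (hcg : HasCompactSupport g) :
    ∃ C : ℝ, 0 < C ∧
      ∀ x, ‖(ω ⋆[ContinuousLinearMap.lsmul ℝ ℝ, volume] g) x‖ ≤ C * ω x := by
  obtain ⟨R, hR⟩ := hcg.isCompact.isBounded.exists_norm_le
  have hint : Integrable (fun t => ‖g t‖) := (hg.integrable_of_hasCompactSupport hcg).norm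
  have hI : 0 ≤ ∫ t, ‖g t‖ := integral_nonneg fun _ => norm_nonneg _
  refine ⟨C₀ * Real.exp (c₀ * R) * ((∫ t, ‖g t‖) + 1), by positivity, fun x => ?_⟩
  have hx := hωpos x
  have hle : ∀ t, ‖ω t • g (x - t)‖ ≤ C₀ * Real.exp (c₀ * R) * ω x * ‖g (x - t)‖ := by
    intro t
    rw [norm_smul, Real.norm_of_nonneg (hωpos t).le]
    by_cases ht : g (x - t) = 0
    · simp [ht]
    · have hmem : ‖t - x‖ ≤ R := by
        rw [norm_sub_rev]
        exact hR _ (subset_tsupport g ht)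
      gcongr
      exact le_of_exponentialType_of_norm_sub_le hc₀ hC₀ hωpos hmod hmem
  calc ‖(ω ⋆[ContinuousLinearMap.lsmul ℝ ℝ, volume] g) x‖
      = ‖∫ t, ω t • g (x - t)‖ := by simp [convolution_def]
    _ ≤ ∫ t, C₀ * Real.exp (c₀ * R) * ω x * ‖g (x - t)‖ :=
        norm_integral_le_of_norm_le ((hint.comp_sub_left x).const_mul _) (Eventually.of_forall hle)
    _ = C₀ * Real.exp (c₀ * R) * ω x * ∫ t, ‖g t‖ := by
        rw [integral_const_mul, integral_sub_left_eq_self (fun t => ‖g t‖)]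
    _ ≤ C₀ * Real.exp (c₀ * R) * ω x * ((∫ t, ‖g t‖) + 1) := by gcongr; linarith
    _ = C₀ * Real.exp (c₀ * R) * ((∫ t, ‖g t‖) + 1) * ω x := by ring

/-- All iterated derivatives of the convolution of a weight of exponential type with a test
function are dominated by the weight. -/
lemma exists_norm_iteratedFDeriv_convolution_le_of_exponentialType {d : ℕ} {c₀ C₀ : ℝ}
    (hc₀ : 0 < c₀) (hC₀ : 0 < C₀) {ω : RSp d → ℝ} (hωpos : ∀ x, 0 < ω x)
    (hωmeas : Measurable ω)
    (hmod : ∀ x y : RSp d, ω (x + y) ≤ C₀ * ω x * Real.exp (c₀ * ‖y‖)) (n : ℕ)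
    {F : Type} [NormedAddCommGroup F] [NormedSpace ℝ F] {g : RSp d → F}
    (hg : ContDiff ℝ (⊤ : ℕ∞) g) (hcg : HasCompactSupport g) :
    ∃ C : ℝ, 0 < C ∧ ∀ x,
      ‖iteratedFDeriv ℝ n (ω ⋆[ContinuousLinearMap.lsmul ℝ ℝ, volume] g) x‖ ≤ C * ω x := by
  induction n generalizing F with
  | zero =>
    simpa only [norm_iteratedFDeriv_zero] using
      exists_norm_convolution_le_of_exponentialType hc₀ hC₀ hωpos hmod hg.continuous hcg
  | succ n ih =>
    have hfderiv : fderiv ℝ (ω ⋆[ContinuousLinearMap.lsmul ℝ ℝ, volume] g) =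
        ω ⋆[ContinuousLinearMap.lsmul ℝ ℝ, volume] fderiv ℝ g := by
      ext1 x
      rw [(hcg.hasFDerivAt_convolution_right (ContinuousLinearMap.lsmul ℝ ℝ)
        (locallyIntegrable_of_exponentialType hωpos hωmeas hmod)
        (hg.of_le (by exact_mod_cast le_top)) x).fderiv]
      rfl
    simp only [← norm_iteratedFDeriv_fderiv, hfderiv]
    exact ih (hg.fderiv_right (by simp)) (hcg.fderiv ℝ)

/-- A weight of exponential type is dominated by its convolution with a normed bump function. -/
lemma exists_le_convolution_normed_of_exponentialType {d : ℕ} {c₀ C₀ : ℝ} (hc₀ : 0 < c₀)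
    (hC₀ : 0 < C₀) {ω : RSp d → ℝ} (hωpos : ∀ x, 0 < ω x) (hωmeas : Measurable ω)
    (hmod : ∀ x y : RSp d, ω (x + y) ≤ C₀ * ω x * Real.exp (c₀ * ‖y‖))
    (φ : ContDiffBump (0 : RSp d)) :
    ∃ C : ℝ, 0 < C ∧
      ∀ x, ω x ≤ C * (ω ⋆[ContinuousLinearMap.lsmul ℝ ℝ, volume] φ.normed volume) x := by
  refine ⟨C₀ * Real.exp (c₀ * φ.rOut), by positivity, fun x => ?_⟩
  have hexists : Integrable fun t => ω t * φ.normed volume (x - t) := by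
    simpa [ConvolutionExistsAt] using
      φ.hasCompactSupport_normed.convolutionExists_right (ContinuousLinearMap.lsmul ℝ ℝ)
        (locallyIntegrable_of_exponentialType hωpos hωmeas hmod) φ.continuous_normed x
  calc ω x = ∫ t, ω x * φ.normed volume (x - t) := by
        rw [integral_const_mul, integral_sub_left_eq_self (φ.normed volume), φ.integral_normed,
          mul_one]
    _ ≤ ∫ t, C₀ * Real.exp (c₀ * φ.rOut) * (ω t * φ.normed volume (x - t)) := by
        refine integral_mono ((φ.integrable_normed.comp_sub_left x).const_mul _)
          (hexists.const_mul _) fun t => ?_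
        by_cases ht : φ.normed volume (x - t) = 0
        · simp [ht]
        · have hmem : x - t ∈ Metric.ball (0 : RSp d) φ.rOut := by
            rw [← φ.support_normed_eq (μ := volume)]
            exact ht
          rw [mem_ball_zero_iff] at hmem
          have hle := mul_le_mul_of_nonneg_right
            (le_of_exponentialType_of_norm_sub_le hc₀ hC₀ hωpos hmod hmem.le)
            (φ.nonneg_normed (μ := volume) (x - t))
          simpa only [mul_assoc] using hle
    _ = _ := by
        rw [integral_const_mul]
        simp [convolution_def]

/-- every weight of exponential type is equivalent to a smooth elliptic weight
of exponential type (with the same exponential rate `c₀`). -/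
theorem stmt12 (d : ℕ) (hd : 1 ≤ d) (c₀ C₀ : ℝ) (hc₀ : 0 < c₀) (hC₀ : 0 < C₀)
    (ω : RSp d → ℝ) (hωpos : ∀ x, 0 < ω x) (hωmeas : Measurable ω)
    (hmod : ∀ x y : RSp d, ω (x + y) ≤ C₀ * ω x * Real.exp (c₀ * ‖y‖)) :
    ∃ ω₀ : RSp d → ℝ, (∀ x, 0 < ω₀ x) ∧ ContDiff ℝ (⊤ : ℕ∞) ω₀ ∧
      (∃ C : ℝ, 0 < C ∧ ∀ x, ω₀ x / C ≤ ω x ∧ ω x ≤ C * ω₀ x) ∧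
      (∃ C₁ : ℝ, 0 < C₁ ∧ ∀ x y : RSp d, ω₀ (x + y) ≤ C₁ * ω₀ x * Real.exp (c₀ * ‖y‖)) ∧
      (∀ n : ℕ, ∃ Cn : ℝ, 0 < Cn ∧ ∀ x, ‖iteratedFDeriv ℝ n ω₀ x‖ ≤ Cn * ω₀ x) := by
  obtain ⟨φ⟩ : Nonempty (ContDiffBump (0 : RSp d)) := inferInstance
  have hloc := locallyIntegrable_of_exponentialType hωpos hωmeas hmod
  have hφ : ContDiff ℝ (⊤ : ℕ∞) (φ.normed volume) := φ.contDiff_normed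
  have hcφ : HasCompactSupport (φ.normed (volume : Measure (RSp d))) := φ.hasCompactSupport_normed
  obtain ⟨A, hA, hupper⟩ :=
    exists_norm_convolution_le_of_exponentialType hc₀ hC₀ hωpos hmod hφ.continuous hcφ
  obtain ⟨B, hB, hlower⟩ :=
    exists_le_convolution_normed_of_exponentialType hc₀ hC₀ hωpos hωmeas hmod φ
  have hsmooth := hcφ.contDiff_convolution_right (ContinuousLinearMap.lsmul ℝ ℝ) hloc hφ
  have hderiv := fun n => exists_norm_iteratedFDeriv_convolution_le_of_exponentialType
    hc₀ hC₀ hωpos hωmeas hmod n hφ hcφ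
  set ω₀ : RSp d → ℝ := ω ⋆[ContinuousLinearMap.lsmul ℝ ℝ, volume] φ.normed volume
  have hupper' : ∀ x, ω₀ x ≤ A * ω x := fun x => (Real.le_norm_self _).trans (hupper x)
  have hpos : ∀ x, 0 < ω₀ x := fun x =>
    pos_of_mul_pos_right ((hωpos x).trans_le (hlower x)) hB.le
  refine ⟨ω₀, hpos, hsmooth, ⟨A + B, by positivity, fun x => ⟨?_, ?_⟩⟩,
    ⟨A * C₀ * B, by positivity, fun x y => ?_⟩, fun n => ?_⟩
  · rw [div_le_iff₀' (by positivity)]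
    nlinarith [hupper' x, hωpos x]
  · nlinarith [hlower x, hpos x]
  · calc ω₀ (x + y) ≤ A * ω (x + y) := hupper' _
      _ ≤ A * (C₀ * ω x * Real.exp (c₀ * ‖y‖)) := by gcongr; exact hmod x y
      _ ≤ A * (C₀ * (B * ω₀ x) * Real.exp (c₀ * ‖y‖)) := by gcongr; exact hlower x
      _ = A * C₀ * B * ω₀ x * Real.exp (c₀ * ‖y‖) := by ring
  · obtain ⟨K, hK, hbound⟩ := hderiv n
    refine ⟨K * B, by positivity, fun x => (hbound x).trans ?_⟩
    rw [mul_assoc]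
    gcongr
    exact hlower x
end
end

section
/- Let d ≥ 1 and let ω : ℝ^d → (0,∞) be smooth with |∇ω(x)| ≤ C ω(x) and ω(x+y) ≤ C ω(x) e^{C|y|} for all x, y ∈ ℝ^d and some constant C ≥ 1. Then for every ε ∈ (0,1) there is a constant C₀ > 0 such that ω(x) e^{−ε(1−λ²)|x|²/2} ≤ (1 + C₀ √(1−λ)) ω(λx) for all x ∈ ℝ^d and all λ ∈ (0,1). -/
open MeasureTheory Filter
open scoped ENNReal

noncomputable section

/-- If `‖Dω‖ ≤ C ω` for a positive differentiable `ω`, then `log ω` is `C`-Lipschitz, so that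
`ω` grows at most exponentially. -/
theorem le_mul_exp_of_norm_fderiv_le {E : Type*} [NormedAddCommGroup E] [NormedSpace ℝ E]
    {ω : E → ℝ} {C : ℝ} (hpos : ∀ x, 0 < ω x) (hdiff : Differentiable ℝ ω)
    (hgrad : ∀ x, ‖fderiv ℝ ω x‖ ≤ C * ω x) (x y : E) :
    ω x ≤ ω y * Real.exp (C * ‖x - y‖) := by
  have hbound : ∀ z ∈ (Set.univ : Set E), ‖fderiv ℝ (fun w => Real.log (ω w)) z‖ ≤ C := by
    intro z _
    rw [fderiv.log (hdiff z) (hpos z).ne', norm_smul, norm_inv, Real.norm_of_nonneg (hpos z).le,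
      inv_mul_le_iff₀ (hpos z), mul_comm]
    exact hgrad z
  have hlip := convex_univ.norm_image_sub_le_of_norm_fderiv_le
    (fun z _ => (hdiff z).log (hpos z).ne') hbound (Set.mem_univ y) (Set.mem_univ x)
  have hlog : Real.log (ω x) ≤ Real.log (ω y) + C * ‖x - y‖ := by
    linarith [(Real.le_norm_self _).trans hlip]
  calc ω x = Real.exp (Real.log (ω x)) := (Real.exp_log (hpos x)).symm
    _ ≤ Real.exp (Real.log (ω y) + C * ‖x - y‖) := Real.exp_le_exp.mpr hlog
    _ = ω y * Real.exp (C * ‖x - y‖) := by rw [Real.exp_add, Real.exp_log (hpos y)]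

theorem exp_le_one_add_mul_exp (t : ℝ) : Real.exp t ≤ 1 + t * Real.exp t := by
  have h := mul_le_mul_of_nonneg_right (Real.add_one_le_exp (-t)) (Real.exp_pos t).le
  rw [← Real.exp_add, neg_add_cancel, Real.exp_zero] at h
  linarith

/-- Completing the square in the exponent, using `1 - l ^ 2 ≥ 1 - l`. -/
theorem linear_sub_quadratic_le {C ε l r : ℝ} (hε : 0 < ε) (hl0 : 0 ≤ l) (hl1 : l ≤ 1) :
    C * ((1 - l) * r) + -(ε * (1 - l ^ 2) * r ^ 2) / 2 ≤ (1 - l) * (C ^ 2 / (2 * ε)) := by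
  have hsq : C * r - ε * r ^ 2 / 2 ≤ C ^ 2 / (2 * ε) := by
    rw [le_div_iff₀ (by positivity)]
    nlinarith [sq_nonneg (C - ε * r)]
  have hmain := mul_le_mul_of_nonneg_left hsq (sub_nonneg.mpr hl1)
  have hrest : 0 ≤ (1 - l) * (l * (ε * r ^ 2)) :=
    mul_nonneg (sub_nonneg.mpr hl1) (by positivity)
  linarith

/-- for a smooth weight `ω` with `|∇ω| ≤ C ω` and
`ω(x+y) ≤ C ω(x) e^{C|y|}`, for every `ε ∈ (0,1)` there is `C₀ > 0` with
`ω(x) e^{−ε(1−λ²)|x|²/2} ≤ (1 + C₀ √(1−λ)) ω(λx)` for all `x` and `λ ∈ (0,1)`. -/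
theorem stmt14 (d : ℕ) (hd : 1 ≤ d) (C : ℝ) (hC : 1 ≤ C)
    (ω : RSp d → ℝ) (hωpos : ∀ x, 0 < ω x) (hsmooth : ContDiff ℝ (⊤ : ℕ∞) ω)
    (hgrad : ∀ x, ‖fderiv ℝ ω x‖ ≤ C * ω x)
    (hmod : ∀ x y : RSp d, ω (x + y) ≤ C * ω x * Real.exp (C * ‖y‖))
    (ε : ℝ) (hε0 : 0 < ε) (hε1 : ε < 1) :
    ∃ C₀ : ℝ, 0 < C₀ ∧ ∀ (x : RSp d) (lam : ℝ), 0 < lam → lam < 1 →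
      ω x * Real.exp (-(ε * (1 - lam ^ 2) * ‖x‖ ^ 2) / 2) ≤
        (1 + C₀ * Real.sqrt (1 - lam)) * ω (lam • x) := by
  set K : ℝ := C ^ 2 / (2 * ε)
  have hK : 0 < K := by positivity
  refine ⟨K * Real.exp K, by positivity, fun x lam hl0 hl1 => ?_⟩
  have hdist : ‖x - lam • x‖ = (1 - lam) * ‖x‖ := by
    rw [show x - lam • x = (1 - lam) • x by rw [sub_smul, one_smul], norm_smul,
      Real.norm_of_nonneg (by linarith)]
  have hgrowth := le_mul_exp_of_norm_fderiv_le hωpos (hsmooth.differentiable (by simp)) hgrad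
    x (lam • x)
  rw [hdist] at hgrowth
  have hsqrt : 1 - lam ≤ Real.sqrt (1 - lam) :=
    Real.le_sqrt_of_sq_le (by nlinarith)
  have hexp : Real.exp ((1 - lam) * K) ≤ 1 + K * Real.exp K * Real.sqrt (1 - lam) :=
    calc Real.exp ((1 - lam) * K)
        ≤ 1 + (1 - lam) * K * Real.exp ((1 - lam) * K) := exp_le_one_add_mul_exp _
      _ ≤ 1 + Real.sqrt (1 - lam) * K * Real.exp K := by
          gcongr
          nlinarith
      _ = 1 + K * Real.exp K * Real.sqrt (1 - lam) := by ring
  calc ω x * Real.exp (-(ε * (1 - lam ^ 2) * ‖x‖ ^ 2) / 2)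
      ≤ ω (lam • x) * Real.exp (C * ((1 - lam) * ‖x‖)) *
          Real.exp (-(ε * (1 - lam ^ 2) * ‖x‖ ^ 2) / 2) := by gcongr
    _ = ω (lam • x) *
          Real.exp (C * ((1 - lam) * ‖x‖) + -(ε * (1 - lam ^ 2) * ‖x‖ ^ 2) / 2) := by
        rw [Real.exp_add, mul_assoc]
    _ ≤ ω (lam • x) * Real.exp ((1 - lam) * K) :=
        mul_le_mul_of_nonneg_left
          (Real.exp_le_exp.mpr (linear_sub_quadratic_le hε0 hl0.le hl1.le)) (hωpos _).le
    _ ≤ (1 + K * Real.exp K * Real.sqrt (1 - lam)) * ω (lam • x) := by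
        rw [mul_comm]
        exact mul_le_mul_of_nonneg_right hexp (hωpos _).le
end
end

section
/- Let d ≥ 1, t ∈ ℝ, γ ∈ [0,2), and ω(x) = e^{t|x|^γ} for x ∈ ℝ^d. Then: (a) there are constants c, C > 0 with C⁻¹ ω(x) ≤ ω(x+y) ≤ C ω(x) whenever |x| ≥ 2c and |y| ≤ c/|x|; (b) for every ε > 0 there is C > 0 with C⁻¹ e^{−ε|x|²} ≤ ω(x) ≤ C e^{ε|x|²} for all x; and (c) for every ε ∈ (0,1], limsup_{λ→1⁻} sup_{x ∈ ℝ^d} [ ω(√2 x) e^{−ε(1−λ²)|x|²/2} / ω(√2 λx) ] ≤ 1 (in particular, for every ε ∈ (0,1] there are C > 0 and θ ∈ (0,1) such that ω(√2 x) e^{−ε(1−λ²)|x|²/2} ≤ C ω(√2 λx) for all x and all λ ∈ (1−θ,1)). Since −t is also admissible, the same conclusions hold with ω replaced by 1/ω. -/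
open MeasureTheory Filter
open scoped ENNReal

noncomputable section

/-- The weight `ω(x) = e^{t |x|^γ}`. -/
def expWeight {d : ℕ} (t γ : ℝ) (x : RSp d) : ℝ := Real.exp (t * ‖x‖ ^ γ)

/-- For exponents in `[0, 2]`, the function `r ↦ r ^ γ` deviates from `1` at most as much as `r ^ 2`. -/
lemma abs_rpow_sub_one_le {γ r : ℝ} (hγ0 : 0 ≤ γ) (hγ2 : γ ≤ 2) (hr : 0 < r) :
    |r ^ γ - 1| ≤ |r ^ 2 - 1| := by
  rcases le_total r 1 with h | h
  · have h1 : r ^ γ ≤ 1 := Real.rpow_le_one hr.le h hγ0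
    have h2 : r ^ (2 : ℝ) ≤ r ^ γ := Real.rpow_le_rpow_of_exponent_ge hr h hγ2
    rw [Real.rpow_two] at h2
    rw [abs_of_nonpos (by linarith), abs_of_nonpos (by linarith)]
    linarith
  · have h1 : 1 ≤ r ^ γ := Real.one_le_rpow h hγ0
    have h2 : r ^ γ ≤ r ^ (2 : ℝ) := Real.rpow_le_rpow_of_exponent_le h hγ2
    rw [Real.rpow_two] at h2
    rw [abs_of_nonneg (by linarith), abs_of_nonneg (by linarith)]
    linarith

/-- A power with exponent in `[0, 2)` is dominated by any positive multiple of the square, up to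
an additive constant. -/
lemma exists_abs_mul_rpow_le {γ : ℝ} (t : ℝ) (hγ0 : 0 ≤ γ) (hγ2 : γ < 2) {ε : ℝ} (hε : 0 < ε) :
    ∃ M : ℝ, 0 ≤ M ∧ ∀ s : ℝ, 0 ≤ s → |t| * s ^ γ ≤ ε * s ^ 2 + M := by
  have hlim : Tendsto (fun s : ℝ => |t| * s ^ (-(2 - γ))) atTop (nhds 0) := by
    simpa using (tendsto_rpow_neg_atTop (sub_pos.2 hγ2)).const_mul |t|
  obtain ⟨R, hR⟩ := eventually_atTop.1
    ((hlim.eventually (ge_mem_nhds hε)).and (eventually_gt_atTop 0))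
  refine ⟨|t| * (max R 0) ^ γ, by positivity, fun s hs => ?_⟩
  rcases le_total R s with h | h
  · obtain ⟨h1, hs0⟩ := hR s h
    have h2 : |t| * s ^ γ ≤ ε * s ^ 2 := by
      calc |t| * s ^ γ = |t| * s ^ (-(2 - γ)) * s ^ 2 := by
            rw [mul_assoc, ← Real.rpow_two, ← Real.rpow_add hs0]
            congr 2
            ring
        _ ≤ ε * s ^ 2 := by gcongr
    have : 0 ≤ |t| * (max R 0) ^ γ := by positivity
    linarith
  · have h1 : |t| * s ^ γ ≤ |t| * (max R 0) ^ γ := by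
      gcongr
      exact h.trans (le_max_left _ _)
    have : 0 ≤ ε * s ^ 2 := by positivity
    linarith

/-- The power `a ^ γ` with `γ ∈ [0, 2]` changes by a bounded amount when `a` is moved by at most
`1 / a`. -/
lemma abs_rpow_sub_rpow_le {γ a b : ℝ} (hγ0 : 0 ≤ γ) (hγ2 : γ ≤ 2) (ha : 2 ≤ a)
    (hab : |b - a| ≤ 1 / a) : |b ^ γ - a ^ γ| ≤ 3 := by
  have ha0 : 0 < a := by linarith
  have hmul : |b - a| * a ≤ 1 := (le_div_iff₀ ha0).1 hab
  have hd : |b - a| ≤ 1 := by nlinarith [abs_nonneg (b - a)]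
  obtain ⟨hd1, hd2⟩ := abs_le.1 hd
  have hb0 : 0 < b := by linarith
  have hpow : a ^ γ ≤ a ^ 2 := by
    rw [← Real.rpow_two]
    exact Real.rpow_le_rpow_of_exponent_le (by linarith) hγ2
  calc |b ^ γ - a ^ γ| = a ^ γ * |(b / a) ^ γ - 1| := by
        rw [← abs_of_pos (Real.rpow_pos_of_pos ha0 γ), ← abs_mul,
          abs_of_pos (Real.rpow_pos_of_pos ha0 γ), Real.div_rpow hb0.le ha0.le]
        congr 1
        have := (Real.rpow_pos_of_pos ha0 γ).ne'
        field_simp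
    _ ≤ a ^ 2 * |(b / a) ^ 2 - 1| := by
        exact mul_le_mul hpow (abs_rpow_sub_one_le hγ0 hγ2 (div_pos hb0 ha0)) (abs_nonneg _)
          (by positivity)
    _ = |b - a| * (b + a) := by
        have h1 : a ^ 2 * |(b / a) ^ 2 - 1| = |a ^ 2 * ((b / a) ^ 2 - 1)| := by
          rw [abs_mul, abs_of_pos (pow_pos ha0 2)]
        have h2 : |b - a| * (b + a) = |(b - a) * (b + a)| := by
          rw [abs_mul, abs_of_pos (add_pos hb0 ha0)]
        rw [h1, h2]
        congr 1
        field_simp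
        ring
    _ ≤ 3 := by nlinarith [abs_nonneg (b - a)]

/-- The quotient comparing the weight with its dilate tends to at most `1`, with an explicit rate. -/
lemma exists_expWeight_dilate_le (d : ℕ) {γ : ℝ} (t : ℝ) (hγ0 : 0 ≤ γ) (hγ2 : γ < 2) {ε : ℝ}
    (hε : 0 < ε) :
    ∃ M : ℝ, 0 ≤ M ∧ ∀ (x : RSp d) (lam : ℝ), 0 < lam → lam < 1 →
      expWeight t γ (Real.sqrt 2 • x) * Real.exp (-(ε * (1 - lam ^ 2) * ‖x‖ ^ 2) / 2) ≤
        Real.exp ((1 - lam ^ 2) * M) * expWeight t γ (Real.sqrt 2 • (lam • x)) := by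
  obtain ⟨M, hM0, hM⟩ := exists_abs_mul_rpow_le t hγ0 hγ2 (ε := ε / 4) (by positivity)
  refine ⟨M, hM0, fun x lam h0 h1 => ?_⟩
  have hnorm : ‖Real.sqrt 2 • (lam • x)‖ = lam * ‖Real.sqrt 2 • x‖ := by
    rw [smul_comm, norm_smul, Real.norm_of_nonneg h0.le]
  have hsq : ‖Real.sqrt 2 • x‖ ^ 2 = 2 * ‖x‖ ^ 2 := by
    rw [norm_smul, mul_pow, Real.norm_of_nonneg (Real.sqrt_nonneg 2), Real.sq_sqrt (by norm_num)]
  have hu := hM ‖Real.sqrt 2 • x‖ (norm_nonneg _)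
  simp only [expWeight]
  rw [← Real.exp_add, ← Real.exp_add, Real.exp_le_exp, hnorm,
    Real.mul_rpow h0.le (norm_nonneg _)]
  rw [hsq] at hu
  set p := ‖Real.sqrt 2 • x‖ ^ γ with hp
  have hp0 : 0 ≤ p := by positivity
  have hlam : 0 ≤ 1 - lam ^ 2 := by nlinarith
  have hpow := abs_rpow_sub_one_le hγ0 hγ2.le h0
  rw [abs_sub_comm, abs_sub_comm (lam ^ 2), abs_of_nonneg hlam] at hpow
  have key : t * p * (1 - lam ^ γ) ≤ |t| * p * (1 - lam ^ 2) := by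
    calc t * p * (1 - lam ^ γ) ≤ |t * p * (1 - lam ^ γ)| := le_abs_self _
      _ = |t| * p * |1 - lam ^ γ| := by rw [abs_mul, abs_mul, abs_of_nonneg hp0]
      _ ≤ _ := by gcongr
  have := mul_le_mul_of_nonneg_right hu hlam
  linarith

/-- for `ω(x) = e^{t|x|^γ}` with `0 ≤ γ < 2`: (a) the local condition (L);
(b) subgaussian-type two-sided bounds; (c) `ω` is (strongly) dilated suitable, both in the
limsup form and in the `(C,θ)` form.  Since `t` is arbitrary (in particular `−t` is
admissible), the same conclusions hold with `ω` replaced by `1/ω`. -/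
theorem stmt15 (d : ℕ) (hd : 1 ≤ d) (t γ : ℝ) (hγ0 : 0 ≤ γ) (hγ2 : γ < 2) :
    (∃ c C : ℝ, 0 < c ∧ 0 < C ∧ ∀ x y : RSp d, 2 * c ≤ ‖x‖ → ‖y‖ ≤ c / ‖x‖ →
      expWeight t γ x / C ≤ expWeight t γ (x + y) ∧
        expWeight t γ (x + y) ≤ C * expWeight t γ x) ∧
    (∀ ε : ℝ, 0 < ε → ∃ C : ℝ, 0 < C ∧ ∀ x : RSp d,
      Real.exp (-(ε * ‖x‖ ^ 2)) / C ≤ expWeight t γ x ∧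
        expWeight t γ x ≤ C * Real.exp (ε * ‖x‖ ^ 2)) ∧
    (∀ ε : ℝ, 0 < ε → ε ≤ 1 →
      (Filter.limsup
        (fun lam : ℝ => ⨆ x : RSp d,
          expWeight t γ (Real.sqrt 2 • x) * Real.exp (-(ε * (1 - lam ^ 2) * ‖x‖ ^ 2) / 2) /
            expWeight t γ (Real.sqrt 2 • (lam • x)))
        (nhdsWithin 1 (Set.Iio 1)) ≤ 1) ∧
      (∃ C θ : ℝ, 0 < C ∧ 0 < θ ∧ θ < 1 ∧
        ∀ (x : RSp d) (lam : ℝ), 1 - θ < lam → lam < 1 →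
          expWeight t γ (Real.sqrt 2 • x) * Real.exp (-(ε * (1 - lam ^ 2) * ‖x‖ ^ 2) / 2) ≤
            C * expWeight t γ (Real.sqrt 2 • (lam • x)))) := by
  refine ⟨?_, ?_, fun ε hε _ => ?_⟩
  · refine ⟨1, Real.exp (|t| * 3), one_pos, Real.exp_pos _, fun x y hx hy => ?_⟩
    have hab : |‖x + y‖ - ‖x‖| ≤ 1 / ‖x‖ :=
      (abs_norm_sub_norm_le _ _).trans (by simpa using hy)
    have h := abs_rpow_sub_rpow_le hγ0 hγ2.le (by linarith) hab
    have ht : |t * ‖x + y‖ ^ γ - t * ‖x‖ ^ γ| ≤ |t| * 3 := by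
      rw [← mul_sub, abs_mul]
      gcongr
    obtain ⟨h1, h2⟩ := abs_le.1 ht
    simp only [expWeight]
    rw [← Real.exp_sub, ← Real.exp_add, Real.exp_le_exp, Real.exp_le_exp]
    constructor <;> linarith
  · intro ε hε
    obtain ⟨M, -, hM⟩ := exists_abs_mul_rpow_le t hγ0 hγ2 hε
    refine ⟨Real.exp M, Real.exp_pos _, fun x => ?_⟩
    have ht : |t * ‖x‖ ^ γ| ≤ ε * ‖x‖ ^ 2 + M := by
      rw [abs_mul, abs_of_nonneg (by positivity : 0 ≤ ‖x‖ ^ γ)]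
      exact hM _ (norm_nonneg x)
    obtain ⟨h1, h2⟩ := abs_le.1 ht
    simp only [expWeight]
    rw [← Real.exp_sub, ← Real.exp_add, Real.exp_le_exp, Real.exp_le_exp]
    constructor <;> linarith
  · obtain ⟨M, hM0, hM⟩ := exists_expWeight_dilate_le d t hγ0 hγ2 hε
    constructor
    · have hlim : Tendsto (fun lam : ℝ => Real.exp ((1 - lam ^ 2) * M))
          (nhdsWithin 1 (Set.Iio 1)) (nhds 1) := by
        have hc : Continuous fun lam : ℝ => Real.exp ((1 - lam ^ 2) * M) := by fun_prop
        simpa using (hc.tendsto 1).mono_left nhdsWithin_le_nhds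
      refine (limsup_le_limsup ?_ ?_ hlim.isBoundedUnder_le).trans_eq hlim.limsup_eq
      · filter_upwards [self_mem_nhdsWithin,
          mem_nhdsWithin_of_mem_nhds (Ioi_mem_nhds (zero_lt_one' ℝ))] with lam h1 h0
        exact ciSup_le fun x => (div_le_iff₀ (Real.exp_pos _)).2 (hM x lam h0 h1)
      · refine IsBoundedUnder.isCoboundedUnder_le (isBoundedUnder_of ⟨0, fun lam => ?_⟩)
        exact Real.iSup_nonneg fun x => by
          simp only [expWeight]
          positivity
    · refine ⟨Real.exp M, 1 / 2, Real.exp_pos _, by norm_num, by norm_num,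
        fun x lam h0 h1 => (hM x lam (by linarith) h1).trans ?_⟩
      refine mul_le_mul_of_nonneg_right (Real.exp_le_exp.2 ?_) (Real.exp_pos _).le
      nlinarith [sq_nonneg lam]
end
end

section
/- Let d ≥ 1 and let ω : ℝ^d → (0,∞) be locally bounded, bounded from below by a positive constant on every compact set, and satisfy condition (L). Then: (a) there are constants c', C' > 0 with C'⁻¹ e^{−c'|x|²} ≤ ω(x) ≤ C' e^{c'|x|²} for all x; (b) there exists a smooth ω₀ : ℝ^d → (0,∞), satisfying condition (L) and the two-sided Gaussian bound of (a), such that C⁻¹ ω₀ ≤ ω ≤ C ω₀ for some C > 0 and, for every multi-index α, |∂^α ω₀(x)| ≤ C_α ω₀(x) (1+|x|)^{|α|} for all x and some constant C_α; and (c) if moreover ω is rotation invariant (ω(x) depends only on |x|), then ω₀ can be chosen rotation invariant. -/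
open MeasureTheory Filter
open scoped ENNReal

noncomputable section

/-- Condition (L): `C⁻¹ ω(x) ≤ ω(x+y) ≤ C ω(x)` whenever `|x| ≥ 2c` and `|y| ≤ c/|x|`. -/
def CondL {d : ℕ} (ω : RSp d → ℝ) : Prop :=
  ∃ c C : ℝ, 0 < c ∧ 0 < C ∧ ∀ x y : RSp d, 2 * c ≤ ‖x‖ → ‖y‖ ≤ c / ‖x‖ →
    ω x / C ≤ ω (x + y) ∧ ω (x + y) ≤ C * ω x

/-- The two-sided Gaussian bound with constants `c', C'`. -/
def GaussBound {d : ℕ} (ω : RSp d → ℝ) (c' C' : ℝ) : Prop :=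
  ∀ x : RSp d, Real.exp (-(c' * ‖x‖ ^ 2)) / C' ≤ ω x ∧ ω x ≤ C' * Real.exp (c' * ‖x‖ ^ 2)

/-- Rotation invariance: the value depends only on the norm. -/
def RotInv {d : ℕ} (ω : RSp d → ℝ) : Prop :=
  ∀ x y : RSp d, ‖x‖ = ‖y‖ → ω x = ω y

lemma mul_norm_sub_le_one_of_apply_ne_zero {E G : Type*} [NormedAddCommGroup E] [NormedSpace ℝ E]
    [NormedAddCommGroup G] {A : E → ℝ} {φ : E → G} (hA : ∀ y, 1 ≤ A y)
    (hφ : tsupport φ ⊆ Metric.closedBall 0 1) {x y : E} (h : φ (A y • (x - y)) ≠ 0) :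
    A y * ‖x - y‖ ≤ 1 := by
  have := hφ (subset_tsupport φ h)
  rwa [mem_closedBall_zero_iff, norm_smul, Real.norm_of_nonneg (by linarith [hA y])] at this

lemma norm_sub_le_one_of_mul_le {E : Type*} [NormedAddCommGroup E] {A : E → ℝ}
    (hA : ∀ y, 1 ≤ A y) {x y : E} (h : A y * ‖x - y‖ ≤ 1) : ‖x - y‖ ≤ 1 := by
  nlinarith [hA y, norm_nonneg (x - y)]

lemma exists_norm_le_of_tsupport_subset {E G : Type*} [NormedAddCommGroup E] [ProperSpace E]
    [NormedAddCommGroup G] {φ : E → G} (hφc : Continuous φ)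
    (hφ : tsupport φ ⊆ Metric.closedBall 0 1) : ∃ M : ℝ, 0 < M ∧ ∀ v, ‖φ v‖ ≤ M := by
  obtain ⟨M, hM⟩ := hφc.bounded_above_of_compact_support
    ((isCompact_closedBall (0 : E) 1).of_isClosed_subset (isClosed_tsupport φ) hφ)
  exact ⟨max M 1, by positivity, fun v => (hM v).trans (le_max_left _ _)⟩

section ScaledConvolution

variable {E G : Type} [NormedAddCommGroup E] [NormedSpace ℝ E] [FiniteDimensional ℝ E]
  [MeasurableSpace E] [BorelSpace E] [NormedAddCommGroup G] [NormedSpace ℝ G]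
  {μ : Measure E} {A w : E → ℝ} {φ : E → G}

/-- Averaging of the weight `w` against the profile `φ`, rescaled by `A y` around each `y`. -/
def scaledConv (μ : Measure E) (A w : E → ℝ) (φ : E → G) (x : E) : G :=
  ∫ y, w y • φ (A y • (x - y)) ∂μ

lemma integrable_scaledConv_integrand (hA : ∀ y, 1 ≤ A y) (hAc : Continuous A)
    (hw : LocallyIntegrable w μ) (hφc : Continuous φ)
    (hφ : tsupport φ ⊆ Metric.closedBall 0 1) (x : E) :
    Integrable (fun y => w y • φ (A y • (x - y))) μ := by
  refine hw.integrable_smul_right_of_hasCompactSupport (by fun_prop) ?_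
  refine HasCompactSupport.of_support_subset_isCompact (isCompact_closedBall x 1) fun y hy => ?_
  rw [mem_closedBall_iff_norm']
  exact norm_sub_le_one_of_mul_le hA (mul_norm_sub_le_one_of_apply_ne_zero hA hφ hy)

lemma hasFDerivAt_scaledConv (hA : ∀ y, 1 ≤ A y) (hAc : Continuous A)
    (hw : LocallyIntegrable w μ) (hφc : ContDiff ℝ 1 φ)
    (hφ : tsupport φ ⊆ Metric.closedBall 0 1) (x : E) :
    HasFDerivAt (scaledConv μ A w φ)
      (scaledConv μ A (fun y => w y * A y) (fderiv ℝ φ) x) x := by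
  have hφ' : tsupport (fderiv ℝ φ) ⊆ Metric.closedBall 0 1 :=
    (tsupport_fderiv_subset ℝ).trans hφ
  have hφc' : Continuous (fderiv ℝ φ) := hφc.continuous_fderiv one_ne_zero
  have hwA : LocallyIntegrable (fun y => w y * A y) μ := by
    simpa [mul_comm] using hw.continuous_mul hAc
  obtain ⟨M, hM0, hM⟩ := exists_norm_le_of_tsupport_subset hφc' hφ'
  refine hasFDerivAt_integral_of_dominated_of_fderiv_le (Metric.ball_mem_nhds x one_pos)
    (F' := fun z y => (w y * A y) • fderiv ℝ φ (A y • (z - y)))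
    (bound := (Metric.closedBall x 2).indicator fun y => ‖w y * A y‖ * M)
    (Eventually.of_forall fun z =>
      (integrable_scaledConv_integrand hA hAc hw hφc.continuous hφ z).aestronglyMeasurable)
    (integrable_scaledConv_integrand hA hAc hw hφc.continuous hφ x)
    (integrable_scaledConv_integrand hA hAc hwA hφc' hφ' x).aestronglyMeasurable
    (Eventually.of_forall fun y z hz => ?_) ?_ (Eventually.of_forall fun y z hz => ?_)
  · by_cases h : fderiv ℝ φ (A y • (z - y)) = 0
    · simpa [h] using Set.indicator_nonneg (fun _ _ => by positivity) y
    · have h1 := norm_sub_le_one_of_mul_le hA (mul_norm_sub_le_one_of_apply_ne_zero hA hφ' h)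
      rw [Set.indicator_of_mem, norm_smul]
      · gcongr
        exact hM _
      · rw [mem_ball_iff_norm'] at hz
        rw [mem_closedBall_iff_norm']
        linarith [norm_sub_le_norm_sub_add_norm_sub x z y]
  · rw [integrable_indicator_iff Metric.isClosed_closedBall.measurableSet]
    exact (hwA.integrableOn_isCompact (isCompact_closedBall x 2)).norm.mul_const M
  · have h1 : HasFDerivAt (fun z : E => A y • (z - y)) (A y • ContinuousLinearMap.id ℝ E) z :=
      ((hasFDerivAt_id z).sub_const y).const_smul (A y)
    have h2 := ((hφc.differentiable one_ne_zero
      (A y • (z - y))).hasFDerivAt.comp z h1).const_smul (w y)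
    refine h2.congr_fderiv ?_
    ext v
    simp [mul_smul]

lemma contDiff_scaledConv (hA : ∀ y, 1 ≤ A y) (hAc : Continuous A) (n : ℕ) :
    ∀ {G : Type} [NormedAddCommGroup G] [NormedSpace ℝ G] {φ : E → G} {w : E → ℝ},
      LocallyIntegrable w μ → ContDiff ℝ (⊤ : ℕ∞) φ → tsupport φ ⊆ Metric.closedBall 0 1 →
      ContDiff ℝ n (scaledConv μ A w φ) ∧ ∃ M : ℝ, 0 < M ∧ ∀ x,
        ‖iteratedFDeriv ℝ n (scaledConv μ A w φ) x‖ ≤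
          M * ∫ y in {y | A y * ‖x - y‖ ≤ 1}, ‖w y‖ * A y ^ n ∂μ := by
  induction n with
  | zero =>
    intro G _ _ φ w hw hφc hφ
    constructor
    · have h1 : ContDiff ℝ 1 φ := hφc.of_le (by exact_mod_cast le_top)
      exact contDiff_zero.2 (continuous_iff_continuousAt.2 fun x =>
        (hasFDerivAt_scaledConv hA hAc hw h1 hφ x).continuousAt)
    · obtain ⟨M, hM0, hM⟩ := exists_norm_le_of_tsupport_subset hφc.continuous hφ
      refine ⟨M, hM0, fun x => ?_⟩
      have hS : IsClosed {y | A y * ‖x - y‖ ≤ 1} :=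
        isClosed_le (by fun_prop) continuous_const
      have hSc : IsCompact {y | A y * ‖x - y‖ ≤ 1} :=
        (isCompact_closedBall x 1).of_isClosed_subset hS fun y hy => by
          rw [mem_closedBall_iff_norm']
          exact norm_sub_le_one_of_mul_le hA hy
      rw [norm_iteratedFDeriv_zero, ← integral_const_mul, ← integral_indicator hS.measurableSet]
      refine norm_integral_le_of_norm_le ?_ (Eventually.of_forall fun y => ?_)
      · rw [integrable_indicator_iff hS.measurableSet]
        simpa [IntegrableOn] using (hw.integrableOn_isCompact hSc).norm.const_mul M
      · by_cases h : φ (A y • (x - y)) = 0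
        · simpa [h] using Set.indicator_nonneg (fun _ _ => by positivity) y
        · rw [Set.indicator_of_mem (show y ∈ {y | A y * ‖x - y‖ ≤ 1} from
            mul_norm_sub_le_one_of_apply_ne_zero hA hφ h), norm_smul, pow_zero, mul_one, mul_comm]
          gcongr
          exact hM _
  | succ n ih =>
    intro G _ _ φ w hw hφc hφ
    have h1 : ContDiff ℝ 1 φ := hφc.of_le (by exact_mod_cast le_top)
    have hwA : LocallyIntegrable (fun y => w y * A y) μ := by
      simpa [mul_comm] using hw.continuous_mul hAc
    have hd := fun x => hasFDerivAt_scaledConv hA hAc hw h1 hφ x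
    obtain ⟨ih1, M, hM0, hM⟩ := ih hwA (hφc.fderiv_right (m := (⊤ : ℕ∞)) (by simp))
      ((tsupport_fderiv_subset ℝ).trans hφ)
    have he : fderiv ℝ (scaledConv μ A w φ) =
        scaledConv μ A (fun y => w y * A y) (fderiv ℝ φ) := funext fun x => (hd x).fderiv
    refine ⟨?_, M, hM0, fun x => ?_⟩
    · push_cast
      exact contDiff_succ_iff_hasFDerivAt.2 ⟨_, ih1, hd⟩
    · rw [← norm_iteratedFDeriv_fderiv, he]
      convert hM x using 4 with y
      rw [norm_mul, Real.norm_of_nonneg (by linarith [hA y] : 0 ≤ A y), pow_succ']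
      ring

end ScaledConvolution

/-- `ω` varies at most by the factor `K` on balls of radius `ε / (1 + ‖x‖)`. -/
def SlowlyVarying {d : ℕ} (ε K : ℝ) (ω : RSp d → ℝ) : Prop :=
  ∀ x y : RSp d, (1 + ‖x‖) * ‖x - y‖ ≤ ε → ω y ≤ K * ω x ∧ ω x ≤ K * ω y

section Weights

variable {d : ℕ} {ω : RSp d → ℝ} {ε K : ℝ}

lemma exists_slowlyVarying (hωpos : ∀ x, 0 < ω x)
    (hloc : ∀ K : Set (RSp d), IsCompact K → ∃ m M : ℝ, 0 < m ∧ ∀ x ∈ K, m ≤ ω x ∧ ω x ≤ M)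
    (hL : CondL ω) :
    ∃ ε K : ℝ, 0 < ε ∧ ε ≤ 1 ∧ 1 ≤ K ∧ SlowlyVarying ε K ω := by
  obtain ⟨c, C, hc, hC, hcC⟩ := hL
  obtain ⟨m, M, hm, hmM⟩ := hloc _ (isCompact_closedBall (0 : RSp d) (2 * c + 1))
  refine ⟨min c 1, max (max C (M / m)) 1, by positivity, min_le_right _ _, le_max_right _ _,
    fun x y hxy => ?_⟩
  have hx0 := norm_nonneg x
  have hxy0 := norm_nonneg (x - y)
  have hxy1 : (1 + ‖x‖) * ‖x - y‖ ≤ 1 := hxy.trans (min_le_right _ _)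
  have hxyc : (1 + ‖x‖) * ‖x - y‖ ≤ c := hxy.trans (min_le_left _ _)
  have key : ∀ u v, ∀ B ≤ max (max C (M / m)) 1, ω u ≤ B * ω v →
      ω u ≤ max (max C (M / m)) 1 * ω v := fun u v B hB h =>
    h.trans (mul_le_mul_of_nonneg_right hB (hωpos v).le)
  rcases le_total (2 * c) ‖x‖ with h | h
  · have := hcC x (y - x) h (by
      rw [le_div_iff₀ (by linarith), norm_sub_rev]
      nlinarith)
    rw [add_sub_cancel, div_le_iff₀ hC, mul_comm _ C] at this
    have hCle : C ≤ max (max C (M / m)) 1 := (le_max_left _ _).trans (le_max_left _ _)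
    exact ⟨key _ _ _ hCle this.2, key _ _ _ hCle this.1⟩
  · have hxK := hmM x (by rw [mem_closedBall_zero_iff]; linarith)
    have hyK := hmM y (by
      rw [mem_closedBall_zero_iff]
      have : ‖y‖ ≤ ‖x‖ + ‖x - y‖ := norm_le_norm_add_norm_sub x y
      nlinarith)
    have hle : M / m ≤ max (max C (M / m)) 1 := (le_max_right _ _).trans (le_max_left _ _)
    have aux : ∀ u v, ω u ≤ M → m ≤ ω v → ω u ≤ M / m * ω v := fun u v hu hv => by
      rw [div_mul_eq_mul_div, le_div_iff₀ hm]
      have := hωpos u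
      exact mul_le_mul hu hv hm.le (by linarith)
    exact ⟨key _ _ _ hle (aux _ _ hyK.2 hxK.1), key _ _ _ hle (aux _ _ hxK.2 hyK.1)⟩

lemma SlowlyVarying.comparable_smul (hω : SlowlyVarying ε K ω) (hK : 1 ≤ K) (x : RSp d) (N : ℕ)
    (hN : 0 < N) (hx : (1 + ‖x‖) * ‖x‖ ≤ ε * N) (k : ℕ) (hk : k ≤ N) :
    ω ((k / N : ℝ) • x) ≤ K ^ k * ω 0 ∧ ω 0 ≤ K ^ k * ω ((k / N : ℝ) • x) := by
  have hN' : (0 : ℝ) < N := by exact_mod_cast hN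
  induction k with
  | zero => simp
  | succ k ih =>
    obtain ⟨h1, h2⟩ := ih (by lia)
    have hkN : (k / N : ℝ) ≤ 1 := by
      rw [div_le_one hN']
      exact_mod_cast (by lia : k ≤ N)
    have hd : (k / N : ℝ) • x - ((k + 1 : ℕ) / N : ℝ) • x = -((1 / N : ℝ) • x) := by
      rw [← sub_smul, ← neg_smul]
      congr 1
      push_cast
      ring
    obtain ⟨h3, h4⟩ := hω ((k / N : ℝ) • x) (((k + 1 : ℕ) / N : ℝ) • x) (by
      rw [hd, norm_neg, norm_smul, norm_smul, Real.norm_of_nonneg (by positivity),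
        Real.norm_of_nonneg (by positivity)]
      calc (1 + k / N * ‖x‖) * (1 / N * ‖x‖) ≤ (1 + 1 * ‖x‖) * (1 / N * ‖x‖) := by gcongr
        _ = ((1 + ‖x‖) * ‖x‖) / N := by ring
        _ ≤ ε := by rwa [div_le_iff₀ hN'])
    constructor
    · calc _ ≤ K * ω ((k / N : ℝ) • x) := h3
        _ ≤ K * (K ^ k * ω 0) := by gcongr
        _ = _ := by ring
    · calc _ ≤ K ^ k * ω ((k / N : ℝ) • x) := h2
        _ ≤ K ^ k * (K * ω (((k + 1 : ℕ) / N : ℝ) • x)) := by gcongr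
        _ = _ := by ring

lemma SlowlyVarying.exists_gaussBound (hω : SlowlyVarying ε K ω) (hε : 0 < ε) (hK : 1 ≤ K)
    (hωpos : ∀ x, 0 < ω x) : ∃ c' C' : ℝ, 0 < c' ∧ 0 < C' ∧ GaussBound ω c' C' := by
  have hl : 0 ≤ Real.log K := Real.log_nonneg hK
  set c' := 2 * Real.log K / ε + 1 with hc'
  set D := Real.exp (Real.log K * (1 / ε + 2)) with hD
  have h0 := hωpos 0
  refine ⟨c', D * max (ω 0) (1 / ω 0), by positivity, by positivity, fun x => ?_⟩
  have hx0 := norm_nonneg x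
  set N : ℕ := ⌈(1 + ‖x‖) * ‖x‖ / ε⌉₊ + 1 with hN
  have hN1 : (1 + ‖x‖) * ‖x‖ / ε ≤ N := by
    push_cast [hN]
    linarith [Nat.le_ceil ((1 + ‖x‖) * ‖x‖ / ε)]
  have hN2 : (N : ℝ) ≤ (1 + 2 * ‖x‖ ^ 2) / ε + 2 := by
    have h1 := (Nat.ceil_lt_add_one (by positivity : 0 ≤ (1 + ‖x‖) * ‖x‖ / ε)).le
    have h2 : (1 + ‖x‖) * ‖x‖ / ε ≤ (1 + 2 * ‖x‖ ^ 2) / ε := by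
      gcongr
      nlinarith [sq_nonneg (‖x‖ - 1)]
    push_cast [hN]
    linarith
  have hNpos : 0 < N := by lia
  have hKN : K ^ N ≤ D * Real.exp (c' * ‖x‖ ^ 2) := by
    rw [← Real.exp_log (by linarith : 0 < K), ← Real.exp_nat_mul, hD, ← Real.exp_add]
    apply Real.exp_le_exp.2
    calc N * Real.log K ≤ ((1 + 2 * ‖x‖ ^ 2) / ε + 2) * Real.log K := by gcongr
      _ = Real.log K * (1 / ε + 2) + 2 * Real.log K / ε * ‖x‖ ^ 2 := by ring
      _ ≤ _ := by
        rw [hc', add_mul]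
        linarith [sq_nonneg ‖x‖]
  obtain ⟨h1, h2⟩ := hω.comparable_smul hK x N hNpos
    (by rwa [div_le_iff₀ hε, mul_comm (N : ℝ)] at hN1) N le_rfl
  rw [div_self (by positivity), one_smul] at h1 h2
  have hx := hωpos x
  constructor
  · rw [div_le_iff₀ (by positivity), Real.exp_neg, inv_le_iff_one_le_mul₀ (by positivity)]
    calc (1 : ℝ) = 1 / ω 0 * ω 0 := by field_simp
      _ ≤ max (ω 0) (1 / ω 0) * (K ^ N * ω x) := by
        gcongr
        exact le_max_right _ _
      _ ≤ max (ω 0) (1 / ω 0) * ((D * Real.exp (c' * ‖x‖ ^ 2)) * ω x) := by gcongr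
      _ = _ := by ring
  · calc ω x ≤ K ^ N * ω 0 := h1
      _ ≤ (D * Real.exp (c' * ‖x‖ ^ 2)) * max (ω 0) (1 / ω 0) := by
        gcongr
        exact le_max_left _ _
      _ = _ := by ring

lemma CondL.of_equiv {ω₀ : RSp d → ℝ} (hL : CondL ω) {B : ℝ} (hB : 0 < B)
    (h : ∀ x, ω₀ x / B ≤ ω x ∧ ω x ≤ B * ω₀ x) : CondL ω₀ := by
  obtain ⟨c, C, hc, hC, hcC⟩ := hL
  refine ⟨c, B * C * B, hc, by positivity, fun x y hx hy => ?_⟩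
  obtain ⟨h1, h2⟩ := hcC x y hx hy
  have h3 := h x
  have h4 := h (x + y)
  rw [div_le_iff₀ (by positivity)] at h1 h3 h4 ⊢
  constructor
  · calc ω₀ x ≤ ω x * B := h3.1
      _ ≤ ω (x + y) * C * B := by gcongr
      _ ≤ (B * ω₀ (x + y)) * C * B := by gcongr; exact h4.2
      _ = _ := by ring
  · calc ω₀ (x + y) ≤ ω (x + y) * B := h4.1
      _ ≤ (C * ω x) * B := by gcongr
      _ ≤ (C * (B * ω₀ x)) * B := by gcongr; exact h3.2
      _ = _ := by ring

lemma GaussBound.of_equiv {ω₀ : RSp d → ℝ} {c' C' : ℝ} (hG : GaussBound ω c' C') (hC' : 0 < C')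
    {B : ℝ} (hB : 0 < B) (h : ∀ x, ω₀ x / B ≤ ω x ∧ ω x ≤ B * ω₀ x) :
    GaussBound ω₀ c' (C' * B) := by
  intro x
  obtain ⟨h1, h2⟩ := hG x
  have h3 := h x
  rw [div_le_iff₀ (by positivity)] at h1 h3 ⊢
  constructor
  · calc _ ≤ ω x * C' := h1
      _ ≤ (B * ω₀ x) * C' := by gcongr; exact h3.2
      _ = _ := by ring
  · calc _ ≤ ω x * B := h3.1
      _ ≤ (C' * Real.exp (c' * ‖x‖ ^ 2)) * B := by gcongr
      _ = _ := by ring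

/-- Supremum of `ω` over the ball of radius `ε / (1 + ‖y‖)` around `y`. -/
def supRegularization (ε : ℝ) (ω : RSp d → ℝ) (y : RSp d) : ℝ :=
  sSup (Set.image ω {z | (1 + ‖y‖) * ‖y - z‖ < ε})

lemma SlowlyVarying.bddAbove (hω : SlowlyVarying ε K ω) (y : RSp d) :
    BddAbove (Set.image ω {z | (1 + ‖y‖) * ‖y - z‖ < ε}) := by
  refine ⟨K * ω y, ?_⟩
  rintro _ ⟨z, hz, rfl⟩
  exact (hω y z (le_of_lt hz)).1

lemma SlowlyVarying.le_supRegularization (hω : SlowlyVarying ε K ω) (hε : 0 < ε) (y : RSp d) :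
    ω y ≤ supRegularization ε ω y :=
  le_csSup (hω.bddAbove y) ⟨y, by simpa using hε, rfl⟩

lemma SlowlyVarying.supRegularization_le (hω : SlowlyVarying ε K ω) (hε : 0 < ε) (y : RSp d) :
    supRegularization ε ω y ≤ K * ω y := by
  refine csSup_le ⟨ω y, y, by simpa using hε, rfl⟩ ?_
  rintro _ ⟨z, hz, rfl⟩
  exact (hω y z (le_of_lt hz)).1

lemma SlowlyVarying.lowerSemicontinuous_supRegularization (hω : SlowlyVarying ε K ω)
    (hε : 0 < ε) : LowerSemicontinuous (supRegularization ε ω) := by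
  intro y t ht
  obtain ⟨_, ⟨z, hz, rfl⟩, htz⟩ :=
    exists_lt_of_lt_csSup (⟨ω y, y, by simpa using hε, rfl⟩ :
      (Set.image ω {z | (1 + ‖y‖) * ‖y - z‖ < ε}).Nonempty) ht
  have hopen : IsOpen {y' : RSp d | (1 + ‖y'‖) * ‖y' - z‖ < ε} :=
    isOpen_lt (by fun_prop) continuous_const
  filter_upwards [hopen.mem_nhds hz] with y' hy'
  exact htz.trans_le (le_csSup (hω.bddAbove y') ⟨z, hy', rfl⟩)

lemma supRegularization_comp_isometry (e : RSp d ≃ₗᵢ[ℝ] RSp d) (hω : ∀ z, ω (e z) = ω z)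
    (y : RSp d) : supRegularization ε ω (e y) = supRegularization ε ω y := by
  unfold supRegularization
  congr 1
  ext t
  constructor
  · rintro ⟨z, hz, rfl⟩
    refine ⟨e.symm z, ?_, by rw [← hω, e.apply_symm_apply]⟩
    have : ‖e y - z‖ = ‖y - e.symm z‖ := by
      rw [← e.norm_map (y - e.symm z), map_sub, e.apply_symm_apply]
    simpa [← this] using hz
  · rintro ⟨z, hz, rfl⟩
    refine ⟨e z, ?_, hω z⟩
    simpa [← map_sub] using hz

/-- A smooth radial cutoff, supported in the unit ball. -/
def radialCutoff (v : RSp d) : ℝ := Real.smoothTransition (2 - 2 * ‖v‖ ^ 2)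

lemma contDiff_radialCutoff : ContDiff ℝ (⊤ : ℕ∞) (radialCutoff (d := d)) :=
  Real.smoothTransition.contDiff.comp (contDiff_const.sub (contDiff_const.mul (contDiff_norm_sq ℝ)))

lemma tsupport_radialCutoff_subset :
    tsupport (radialCutoff (d := d)) ⊆ Metric.closedBall 0 1 := by
  refine closure_minimal (fun v hv => ?_) Metric.isClosed_closedBall
  rw [mem_closedBall_zero_iff]
  by_contra! h
  exact hv (Real.smoothTransition.zero_of_nonpos (by nlinarith))

lemma radialCutoff_eq_one {v : RSp d} (hv : ‖v‖ ≤ 1 / 2) : radialCutoff v = 1 :=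
  Real.smoothTransition.one_of_one_le (by nlinarith [norm_nonneg v])

lemma radialCutoff_nonneg (v : RSp d) : 0 ≤ radialCutoff v := Real.smoothTransition.nonneg _

lemma one_add_norm_le_two_mul {E : Type*} [SeminormedAddCommGroup E] {x y : E}
    (h : (1 + ‖y‖) * ‖x - y‖ ≤ 1) :
    1 + ‖x‖ ≤ 2 * (1 + ‖y‖) ∧ 1 + ‖y‖ ≤ 2 * (1 + ‖x‖) := by
  have h0 := norm_nonneg (x - y)
  have hy := norm_nonneg y
  have hx := norm_nonneg x
  have h1 : ‖x - y‖ ≤ 1 := by nlinarith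
  have h2 : ‖x‖ ≤ ‖y‖ + ‖x - y‖ := norm_le_norm_add_norm_sub' x y
  have h3 : ‖y‖ ≤ ‖x‖ + ‖x - y‖ := norm_le_norm_add_norm_sub x y
  constructor <;> linarith

/-- The inverse length scale of the regularization. -/
def invScale (ε : ℝ) (y : RSp d) : ℝ := (1 + ‖y‖) / ε

/-- The smooth weight equivalent to `ω`. -/
def smoothWeight (ε : ℝ) (ω : RSp d → ℝ) : RSp d → ℝ :=
  scaledConv volume (invScale ε) (fun y => supRegularization ε ω y * invScale ε y ^ d)
    radialCutoff

lemma one_le_invScale (hε : 0 < ε) (hε1 : ε ≤ 1) (y : RSp d) : 1 ≤ invScale ε y := by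
  rw [invScale, le_div_iff₀ hε]
  linarith [norm_nonneg y]

lemma continuous_invScale : Continuous (invScale (d := d) ε) := by
  unfold invScale
  fun_prop

lemma SlowlyVarying.locallyIntegrable (hω : SlowlyVarying ε K ω) (hε : 0 < ε) (hK : 1 ≤ K)
    (hωpos : ∀ x, 0 < ω x) :
    LocallyIntegrable (fun y => supRegularization ε ω y * invScale ε y ^ d) volume := by
  have hm : Measurable (supRegularization ε ω) :=
    (hω.lowerSemicontinuous_supRegularization hε).measurable
  have h : LocallyIntegrable (supRegularization ε ω) volume := by
    intro x
    have hopen : IsOpen {y : RSp d | (1 + ‖x‖) * ‖x - y‖ < ε} :=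
      isOpen_lt (by fun_prop) continuous_const
    refine ⟨Metric.ball x 1 ∩ {y : RSp d | (1 + ‖x‖) * ‖x - y‖ < ε}, Filter.inter_mem
      (Metric.ball_mem_nhds x one_pos) (hopen.mem_nhds (by simpa using hε)), ?_⟩
    refine Measure.integrableOn_of_bounded (M := K * (K * ω x))
      ((measure_mono Set.inter_subset_left).trans_lt measure_ball_lt_top).ne
      hm.aestronglyMeasurable ?_
    refine (ae_restrict_iff' (Metric.isOpen_ball.inter hopen).measurableSet).2
      (Eventually.of_forall fun y hy => ?_)
    rw [Real.norm_of_nonneg ((hωpos y).le.trans (hω.le_supRegularization hε y))]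
    calc _ ≤ K * ω y := hω.supRegularization_le hε y
      _ ≤ K * (K * ω x) := by
        gcongr
        exact (hω x y (le_of_lt hy.2)).1
  simpa [mul_comm] using h.continuous_mul ((continuous_invScale (ε := ε)).pow d)

/-- The local mass of the regularized weight is controlled by `ω`. -/
lemma SlowlyVarying.setIntegral_le (hω : SlowlyVarying ε K ω) (hε : 0 < ε) (hε1 : ε ≤ 1)
    (hK : 1 ≤ K) (hωpos : ∀ x, 0 < ω x) (n : ℕ) (x : RSp d) :
    ∫ y in {y | invScale ε y * ‖x - y‖ ≤ 1},
        ‖supRegularization ε ω y * invScale ε y ^ d‖ * invScale ε y ^ n ≤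
      K ^ 2 * 4 ^ d * (2 / ε) ^ n * volume.real (Metric.closedBall (0 : RSp d) 1) * ω x *
        (1 + ‖x‖) ^ n := by
  have hx0 := norm_nonneg x
  have hωx := hωpos x
  have hmem : ∀ y ∈ {y : RSp d | invScale ε y * ‖x - y‖ ≤ 1}, (1 + ‖y‖) * ‖x - y‖ ≤ ε := by
    intro y (hy : (1 + ‖y‖) / ε * ‖x - y‖ ≤ 1)
    rwa [div_mul_eq_mul_div, div_le_one hε] at hy
  have hsub : {y : RSp d | invScale ε y * ‖x - y‖ ≤ 1} ⊆
      Metric.closedBall x (2 * ε / (1 + ‖x‖)) := by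
    intro y hy
    have h1 := hmem y hy
    rw [mem_closedBall_iff_norm', le_div_iff₀ (by positivity)]
    nlinarith [(one_add_norm_le_two_mul (h1.trans hε1)).1, norm_nonneg (x - y)]
  have hfin : volume {y : RSp d | invScale ε y * ‖x - y‖ ≤ 1} < ∞ :=
    (measure_mono hsub).trans_lt measure_closedBall_lt_top
  have hb := norm_setIntegral_le_of_norm_le_const
    (f := fun y => ‖supRegularization ε ω y * invScale ε y ^ d‖ * invScale ε y ^ n)
    (C := K * (K * ω x) * (2 * (1 + ‖x‖) / ε) ^ d * (2 * (1 + ‖x‖) / ε) ^ n) hfin (by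
      intro y hy
      have h1 := hmem y hy
      have h1A := one_le_invScale hε hε1 y
      have hA : invScale ε y ≤ 2 * (1 + ‖x‖) / ε := by
        unfold invScale
        gcongr
        exact (one_add_norm_le_two_mul (h1.trans hε1)).2
      have hs : supRegularization ε ω y ≤ K * (K * ω x) :=
        (hω.supRegularization_le hε y).trans (by
          gcongr
          exact (hω y x (by rwa [norm_sub_rev])).2)
      have hs0 : 0 ≤ supRegularization ε ω y :=
        (hωpos y).le.trans (hω.le_supRegularization hε y)
      have hA0 : 0 ≤ invScale ε y := by linarith
      rw [Real.norm_of_nonneg (by positivity), Real.norm_of_nonneg (by positivity)]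
      gcongr)
  refine (Real.le_norm_self _).trans (hb.trans ?_)
  calc _ ≤ K * (K * ω x) * (2 * (1 + ‖x‖) / ε) ^ d * (2 * (1 + ‖x‖) / ε) ^ n *
        volume.real (Metric.closedBall x (2 * ε / (1 + ‖x‖))) := by
        gcongr
        exact measure_closedBall_lt_top.ne
    _ = K ^ 2 * ((2 * (1 + ‖x‖) / ε) * (2 * ε / (1 + ‖x‖))) ^ d * (2 * (1 + ‖x‖) / ε) ^ n *
        volume.real (Metric.closedBall (0 : RSp d) 1) * ω x := by
        rw [Measure.addHaar_real_closedBall' _ _ (by positivity), finrank_euclideanSpace_fin,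
          mul_pow (2 * (1 + ‖x‖) / ε)]
        ring
    _ = _ := by
        have : (2 * (1 + ‖x‖) / ε) * (2 * ε / (1 + ‖x‖)) = 4 := by
          field_simp
          norm_num
        rw [this, mul_div_right_comm 2, mul_pow (2 / ε)]
        ring

lemma SlowlyVarying.le_smoothWeight (hω : SlowlyVarying ε K ω) (hε : 0 < ε) (hε1 : ε ≤ 1)
    (hK : 1 ≤ K) (hωpos : ∀ x, 0 < ω x) (x : RSp d) :
    (1 / 8) ^ d * volume.real (Metric.closedBall (0 : RSp d) 1) / K * ω x ≤
      smoothWeight ε ω x := by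
  have hx0 := norm_nonneg x
  have hωx := hωpos x
  set r := ε / (4 * (1 + ‖x‖)) with hr
  have hr0 : 0 < r := by positivity
  have hint := integrable_scaledConv_integrand (one_le_invScale hε hε1)
    (continuous_invScale (d := d)) (hω.locallyIntegrable hε hK hωpos)
    contDiff_radialCutoff.continuous tsupport_radialCutoff_subset x
  have hnonneg : ∀ y, 0 ≤ (supRegularization ε ω y * invScale ε y ^ d) •
      radialCutoff (invScale ε y • (x - y)) := fun y => by
    have := (hωpos y).le.trans (hω.le_supRegularization hε y)
    have := one_le_invScale hε hε1 y
    have := radialCutoff_nonneg (invScale ε y • (x - y))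
    rw [smul_eq_mul]
    positivity
  have hpt : ∀ y ∈ Metric.closedBall x r, ω x / K * ((1 + ‖x‖) / (2 * ε)) ^ d ≤
      (supRegularization ε ω y * invScale ε y ^ d) •
        radialCutoff (invScale ε y • (x - y)) := by
    intro y hy
    rw [mem_closedBall_iff_norm', hr, le_div_iff₀ (by positivity)] at hy
    have h1 : (1 + ‖x‖) * ‖x - y‖ ≤ ε := by nlinarith [norm_nonneg (x - y)]
    obtain ⟨h2, h3⟩ := one_add_norm_le_two_mul (x := y) (y := x)
      (by rw [norm_sub_rev]; exact h1.trans hε1)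
    have hA0 := one_le_invScale hε hε1 y
    rw [radialCutoff_eq_one, smul_eq_mul, mul_one]
    · have h4 : ω x / K ≤ supRegularization ε ω y := by
        rw [div_le_iff₀ (by positivity), mul_comm]
        refine (hω x y h1).2.trans ?_
        gcongr
        exact hω.le_supRegularization hε y
      have h5 : (1 + ‖x‖) / (2 * ε) ≤ invScale ε y := by
        rw [invScale, div_le_div_iff₀ (by positivity) hε]
        nlinarith
      have : 0 ≤ ω x / K := by positivity
      gcongr
      exact this.trans h4
    · rw [norm_smul, Real.norm_of_nonneg (by linarith), invScale, div_mul_eq_mul_div,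
        div_le_iff₀ hε]
      nlinarith [norm_nonneg (x - y)]
  calc _ = ω x / K * ((1 + ‖x‖) / (2 * ε)) ^ d * volume.real (Metric.closedBall x r) := by
        rw [Measure.addHaar_real_closedBall' _ _ hr0.le, finrank_euclideanSpace_fin]
        have : (1 / 8 : ℝ) = (1 + ‖x‖) / (2 * ε) * r := by
          rw [hr]
          field_simp
          norm_num
        rw [this, mul_pow]
        ring
    _ = ∫ y in Metric.closedBall x r, ω x / K * ((1 + ‖x‖) / (2 * ε)) ^ d := by
        rw [setIntegral_const, smul_eq_mul, mul_comm]
    _ ≤ ∫ y in Metric.closedBall x r, (supRegularization ε ω y * invScale ε y ^ d) •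
        radialCutoff (invScale ε y • (x - y)) :=
        setIntegral_mono_on (integrableOn_const measure_closedBall_lt_top.ne) hint.integrableOn
          Metric.isClosed_closedBall.measurableSet hpt
    _ ≤ smoothWeight ε ω x :=
        setIntegral_le_integral hint (Eventually.of_forall hnonneg)

lemma RotInv.rotInv_smoothWeight (hω : RotInv ω) (ε : ℝ) : RotInv (smoothWeight ε ω) := by
  intro x y hxy
  set e : RSp d ≃ₗᵢ[ℝ] RSp d := (Submodule.span ℝ {x - y})ᗮ.reflection with he
  have hex : e x = y := Submodule.reflection_sub hxy
  have hωe : ∀ z, ω (e z) = ω z := fun z => hω _ _ (e.norm_map z)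
  unfold smoothWeight scaledConv
  rw [← e.measurePreserving.integral_comp e.toHomeomorph.measurableEmbedding
    (fun z => (supRegularization ε ω z * invScale ε z ^ d) • radialCutoff (invScale ε z • (y - z)))]
  congr 1
  ext z
  rw [supRegularization_comp_isometry e hωe]
  simp only [invScale, radialCutoff, e.norm_map, norm_smul, ← hex, ← map_sub]

lemma SlowlyVarying.exists_smooth_equiv (hω : SlowlyVarying ε K ω) (hε : 0 < ε) (hε1 : ε ≤ 1)
    (hK : 1 ≤ K) (hωpos : ∀ x, 0 < ω x) :
    ∃ ω₀ : RSp d → ℝ, (∀ x, 0 < ω₀ x) ∧ ContDiff ℝ (⊤ : ℕ∞) ω₀ ∧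
      (∃ C : ℝ, 0 < C ∧ ∀ x, ω₀ x / C ≤ ω x ∧ ω x ≤ C * ω₀ x) ∧
      (∀ n : ℕ, ∃ Cn : ℝ, 0 < Cn ∧ ∀ x : RSp d,
        ‖iteratedFDeriv ℝ n ω₀ x‖ ≤ Cn * ω₀ x * (1 + ‖x‖) ^ n) ∧
      (RotInv ω → RotInv ω₀) := by
  have hV : 0 < volume.real (Metric.closedBall (0 : RSp d) 1) :=
    ENNReal.toReal_pos (Metric.measure_closedBall_pos volume _ one_pos).ne'
      measure_closedBall_lt_top.ne
  set a := (1 / 8) ^ d * volume.real (Metric.closedBall (0 : RSp d) 1) / K with ha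
  have ha0 : 0 < a := by positivity
  have hlow := hω.le_smoothWeight hε hε1 hK hωpos
  have hpos : ∀ x, 0 < smoothWeight ε ω x := fun x => (mul_pos ha0 (hωpos x)).trans_le (hlow x)
  have hder : ∀ n : ℕ, ∃ B : ℝ, 0 < B ∧ ∀ x,
      ‖iteratedFDeriv ℝ n (smoothWeight ε ω) x‖ ≤ B * ω x * (1 + ‖x‖) ^ n := by
    intro n
    obtain ⟨-, M, hM0, hM⟩ := contDiff_scaledConv (one_le_invScale hε hε1)
      (continuous_invScale (d := d)) n (hω.locallyIntegrable hε hK hωpos)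
      contDiff_radialCutoff tsupport_radialCutoff_subset
    refine ⟨M * (K ^ 2 * 4 ^ d * (2 / ε) ^ n * volume.real (Metric.closedBall (0 : RSp d) 1)),
      by positivity, fun x => (hM x).trans ?_⟩
    calc _ ≤ M * _ := mul_le_mul_of_nonneg_left
          (hω.setIntegral_le hε hε1 hK hωpos n x) hM0.le
      _ = _ := by ring
  refine ⟨smoothWeight ε ω, hpos, ?_, ?_, fun n => ?_, fun h => h.rotInv_smoothWeight ε⟩
  · exact contDiff_infty.2 fun n => (contDiff_scaledConv (one_le_invScale hε hε1)
      continuous_invScale n (hω.locallyIntegrable hε hK hωpos)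
      contDiff_radialCutoff tsupport_radialCutoff_subset).1
  · obtain ⟨B, hB, hB'⟩ := hder 0
    refine ⟨max B a⁻¹, by positivity, fun x => ⟨?_, ?_⟩⟩
    · rw [div_le_iff₀ (by positivity), mul_comm]
      have := hB' x
      rw [norm_iteratedFDeriv_zero, Real.norm_of_nonneg (hpos x).le, pow_zero, mul_one] at this
      exact this.trans (mul_le_mul_of_nonneg_right (le_max_left _ _) (hωpos x).le)
    · calc ω x = a⁻¹ * (a * ω x) := by field_simp
        _ ≤ a⁻¹ * smoothWeight ε ω x := by gcongr; exact hlow x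
        _ ≤ _ := mul_le_mul_of_nonneg_right (le_max_right _ _) (hpos x).le
  · obtain ⟨B, hB, hB'⟩ := hder n
    refine ⟨B * a⁻¹, by positivity, fun x => (hB' x).trans ?_⟩
    have : ω x ≤ a⁻¹ * smoothWeight ε ω x := by
      rw [← div_eq_inv_mul, le_div_iff₀ ha0, mul_comm]
      exact hlow x
    calc _ ≤ B * (a⁻¹ * smoothWeight ε ω x) * (1 + ‖x‖) ^ n := by gcongr
      _ = _ := by ring

end Weights

/-- any positive weight satisfying condition (L), locally bounded and locally
bounded below, (a) satisfies a two-sided Gaussian bound, and (b) is equivalent to a smooth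
weight `ω₀` satisfying (L), the Gaussian bound, and the derivative bounds
`|∂^α ω₀(x)| ≤ C_α ω₀(x) (1+|x|)^{|α|}`; (c) if `ω` is rotation invariant then `ω₀` can be
chosen rotation invariant. -/
theorem stmt16 (d : ℕ) (hd : 1 ≤ d)
    (ω : RSp d → ℝ) (hωpos : ∀ x, 0 < ω x)
    (hloc : ∀ K : Set (RSp d), IsCompact K → ∃ m M : ℝ, 0 < m ∧ ∀ x ∈ K, m ≤ ω x ∧ ω x ≤ M)
    (hL : CondL ω) :
    (∃ c' C' : ℝ, 0 < c' ∧ 0 < C' ∧ GaussBound ω c' C') ∧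
    (∃ ω₀ : RSp d → ℝ, (∀ x, 0 < ω₀ x) ∧ ContDiff ℝ (⊤ : ℕ∞) ω₀ ∧ CondL ω₀ ∧
      (∃ c' C' : ℝ, 0 < c' ∧ 0 < C' ∧ GaussBound ω₀ c' C') ∧
      (∃ C : ℝ, 0 < C ∧ ∀ x, ω₀ x / C ≤ ω x ∧ ω x ≤ C * ω₀ x) ∧
      (∀ n : ℕ, ∃ Cn : ℝ, 0 < Cn ∧ ∀ x : RSp d,
        ‖iteratedFDeriv ℝ n ω₀ x‖ ≤ Cn * ω₀ x * (1 + ‖x‖) ^ n)) ∧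
    (RotInv ω →
      ∃ ω₀ : RSp d → ℝ, (∀ x, 0 < ω₀ x) ∧ ContDiff ℝ (⊤ : ℕ∞) ω₀ ∧ CondL ω₀ ∧ RotInv ω₀ ∧
        (∃ c' C' : ℝ, 0 < c' ∧ 0 < C' ∧ GaussBound ω₀ c' C') ∧
        (∃ C : ℝ, 0 < C ∧ ∀ x, ω₀ x / C ≤ ω x ∧ ω x ≤ C * ω₀ x) ∧
        (∀ n : ℕ, ∃ Cn : ℝ, 0 < Cn ∧ ∀ x : RSp d,
          ‖iteratedFDeriv ℝ n ω₀ x‖ ≤ Cn * ω₀ x * (1 + ‖x‖) ^ n)) := by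
  obtain ⟨ε, K, hε, hε1, hK, hω⟩ := exists_slowlyVarying hωpos hloc hL
  obtain ⟨c', C', hc', hC', hG⟩ := hω.exists_gaussBound hε hK hωpos
  obtain ⟨ω₀, hpos, hsmooth, ⟨B, hB, hequiv⟩, hder, hrot⟩ :=
    hω.exists_smooth_equiv hε hε1 hK hωpos
  have hL₀ : CondL ω₀ := hL.of_equiv hB hequiv
  have hG₀ : ∃ c' C' : ℝ, 0 < c' ∧ 0 < C' ∧ GaussBound ω₀ c' C' :=
    ⟨c', C' * B, hc', by positivity, hG.of_equiv hC' hB hequiv⟩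
  exact ⟨⟨c', C', hc', hC', hG⟩,
    ⟨ω₀, hpos, hsmooth, hL₀, hG₀, ⟨B, hB, hequiv⟩, hder⟩,
    fun h => ⟨ω₀, hpos, hsmooth, hL₀, hrot h, hG₀, ⟨B, hB, hequiv⟩, hder⟩⟩
end
end

section
/- Let d ≥ 1 and let f : ℝ^d → ℂ be locally bounded and such that for every ε > 0 there is C_ε > 0 with |f(x)| ≤ C_ε e^{ε|x|²} for all x. Then there exists a rotation invariant function ω : ℝ^d → (0,∞) (ω(x) depends only on |x|), locally bounded and bounded from below by a positive constant, such that |f(x)| ≤ ω(x) for all x, ω satisfies condition (L′) (there are c, C > 0 with C⁻¹ ω(x)² ≤ ω(x+y) ω(x−y) ≤ C ω(x)² whenever |x| ≥ 2c and |y| ≤ c/|x|), and for every ε > 0 there is C > 0 with C⁻¹ e^{−ε|x|²} ≤ ω(x) ≤ C e^{ε|x|²} for all x. -/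
open MeasureTheory Filter
open scoped ENNReal

noncomputable section

/-- The lower envelope, over slopes `ε ∈ (0, 1]`, of the exponentials `t ↦ K ε * e^{ε t}`. -/
def expEnvelope (K : ℝ → ℝ) (t : ℝ) : ℝ :=
  ⨅ ε : Set.Ioc (0 : ℝ) 1, K ε * Real.exp (ε * t)

instance nonempty_Ioc_zero_one : Nonempty (Set.Ioc (0 : ℝ) 1) := ⟨⟨1, one_pos, le_rfl⟩⟩

lemma le_expEnvelope {K : ℝ → ℝ} {t a : ℝ}
    (h : ∀ ε, 0 < ε → ε ≤ 1 → a ≤ K ε * Real.exp (ε * t)) : a ≤ expEnvelope K t :=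
  le_ciInf fun ε => h ε ε.2.1 ε.2.2

lemma expEnvelope_le {K : ℝ → ℝ} (hK : ∀ ε, 0 < ε → 0 ≤ K ε) (t : ℝ) {ε : ℝ}
    (h0 : 0 < ε) (h1 : ε ≤ 1) : expEnvelope K t ≤ K ε * Real.exp (ε * t) := by
  have hbdd : BddBelow (Set.range fun ε : Set.Ioc (0 : ℝ) 1 => K ε * Real.exp (ε * t)) := by
    refine ⟨0, ?_⟩
    rintro _ ⟨δ, rfl⟩
    exact mul_nonneg (hK δ δ.2.1) (Real.exp_pos _).le
  exact ciInf_le hbdd ⟨ε, h0, h1⟩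

/-- The logarithm of the envelope is `1`-Lipschitz. -/
lemma expEnvelope_le_exp_mul {K : ℝ → ℝ} (hK : ∀ ε, 0 < ε → 0 ≤ K ε) {s t r : ℝ}
    (hr : 0 ≤ r) (hst : t ≤ s + r) : expEnvelope K t ≤ Real.exp r * expEnvelope K s := by
  rw [← div_le_iff₀' (Real.exp_pos r)]
  refine le_expEnvelope fun ε h0 h1 => ?_
  rw [div_le_iff₀' (Real.exp_pos r)]
  calc expEnvelope K t ≤ K ε * Real.exp (ε * t) := expEnvelope_le hK t h0 h1
    _ ≤ K ε * Real.exp (r + ε * s) := by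
        have := hK ε h0
        gcongr
        nlinarith
    _ = Real.exp r * (K ε * Real.exp (ε * s)) := by rw [Real.exp_add]; ring

lemma abs_norm_add_sq_sub_norm_sq_le {E : Type*} [SeminormedAddCommGroup E] {x y : E}
    (hx : 2 ≤ ‖x‖) (hy : ‖y‖ ≤ 1 / ‖x‖) : |‖x + y‖ ^ 2 - ‖x‖ ^ 2| ≤ 3 := by
  have hxy : ‖y‖ * ‖x‖ ≤ 1 := (le_div_iff₀ (by linarith)).1 hy
  have hle := norm_add_le x y
  have hge := norm_sub_le_norm_add x y
  have hy0 := norm_nonneg y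
  have hy1 : ‖y‖ ≤ 1 / 2 := by nlinarith
  rw [abs_le]
  constructor <;> nlinarith [norm_nonneg (x + y)]

/-- any locally bounded function dominated by all Gaussians `C_ε e^{ε|x|²}` is
dominated by a rotation invariant weight of weakly subgaussian type. -/
theorem stmt17 (d : ℕ) (hd : 1 ≤ d)
    (f : RSp d → ℂ)
    (hfloc : ∀ K : Set (RSp d), IsCompact K → ∃ M : ℝ, ∀ x ∈ K, ‖f x‖ ≤ M)
    (hfgauss : ∀ ε : ℝ, 0 < ε → ∃ Cε : ℝ, 0 < Cε ∧ ∀ x : RSp d,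
      ‖f x‖ ≤ Cε * Real.exp (ε * ‖x‖ ^ 2)) :
    ∃ ω : RSp d → ℝ,
      -- rotation invariant
      (∀ x y : RSp d, ‖x‖ = ‖y‖ → ω x = ω y) ∧
      -- locally bounded and bounded below by a positive constant
      (∀ K : Set (RSp d), IsCompact K → ∃ M : ℝ, ∀ x ∈ K, ω x ≤ M) ∧
      (∃ m : ℝ, 0 < m ∧ ∀ x, m ≤ ω x) ∧
      -- dominates |f|
      (∀ x, ‖f x‖ ≤ ω x) ∧
      -- condition (L′)
      (∃ c C : ℝ, 0 < c ∧ 0 < C ∧ ∀ x y : RSp d, 2 * c ≤ ‖x‖ → ‖y‖ ≤ c / ‖x‖ →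
        ω x ^ 2 / C ≤ ω (x + y) * ω (x - y) ∧ ω (x + y) * ω (x - y) ≤ C * ω x ^ 2) ∧
      -- two-sided bounds by all Gaussians
      (∀ ε : ℝ, 0 < ε → ∃ C : ℝ, 0 < C ∧ ∀ x : RSp d,
        Real.exp (-(ε * ‖x‖ ^ 2)) / C ≤ ω x ∧ ω x ≤ C * Real.exp (ε * ‖x‖ ^ 2)) := by
  choose! A _ hA using hfgauss
  set K : ℝ → ℝ := fun ε => max (A ε) 1
  have hK1 : ∀ ε, 1 ≤ K ε := fun ε => le_max_right _ _
  have hK0 : ∀ ε, 0 < ε → 0 ≤ K ε := fun ε _ => zero_le_one.trans (hK1 ε)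
  have hone : ∀ x : RSp d, 1 ≤ expEnvelope K (‖x‖ ^ 2) := fun x =>
    le_expEnvelope fun ε h0 _ =>
      one_le_mul_of_one_le_of_one_le (hK1 ε) (Real.one_le_exp (by positivity))
  refine ⟨fun x => expEnvelope K (‖x‖ ^ 2), fun x y h => by simp only [h], ?_,
    ⟨1, one_pos, hone⟩, ?_, ⟨1, Real.exp 3 * Real.exp 3, one_pos, by positivity, ?_⟩, ?_⟩
  · intro S hS
    obtain ⟨R, hR⟩ := hS.isBounded.exists_norm_le
    refine ⟨K 1 * Real.exp (1 * R ^ 2), fun x hx =>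
      (expEnvelope_le hK0 _ one_pos le_rfl).trans ?_⟩
    have := hK0 1 one_pos
    have := hR x hx
    gcongr
  · exact fun x => le_expEnvelope fun ε h0 _ => (hA ε h0 x).trans (by
      gcongr
      exact le_max_left _ _)
  · intro x y hx hy
    have hx2 : 2 ≤ ‖x‖ := by linarith
    have hplus := abs_le.1 (abs_norm_add_sq_sub_norm_sq_le hx2 hy)
    have hminus := abs_le.1 (abs_norm_add_sq_sub_norm_sq_le (y := -y) hx2 (by rwa [norm_neg]))
    rw [← sub_eq_add_neg] at hminus
    have h1 := hone x
    have h2 := hone (x + y)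
    have h3 := hone (x - y)
    have hbound : ∀ {s t : ℝ}, t ≤ s + 3 → expEnvelope K t ≤ Real.exp 3 * expEnvelope K s :=
      fun h => expEnvelope_le_exp_mul hK0 (by norm_num) h
    have p1 := hbound (s := ‖x‖ ^ 2) (t := ‖x + y‖ ^ 2) (by linarith)
    have p2 := hbound (s := ‖x + y‖ ^ 2) (t := ‖x‖ ^ 2) (by linarith)
    have m1 := hbound (s := ‖x‖ ^ 2) (t := ‖x - y‖ ^ 2) (by linarith)
    have m2 := hbound (s := ‖x - y‖ ^ 2) (t := ‖x‖ ^ 2) (by linarith)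
    constructor
    · rw [div_le_iff₀ (by positivity)]
      calc expEnvelope K (‖x‖ ^ 2) ^ 2
          = expEnvelope K (‖x‖ ^ 2) * expEnvelope K (‖x‖ ^ 2) := sq _
        _ ≤ _ := mul_le_mul p2 m2 (by linarith) (by positivity)
        _ = _ := by ring
    · calc expEnvelope K (‖x + y‖ ^ 2) * expEnvelope K (‖x - y‖ ^ 2)
          ≤ _ := mul_le_mul p1 m1 (by linarith) (by positivity)
        _ = _ := by ring
  · intro ε hε
    have hδ : 0 < min ε 1 := lt_min hε one_pos
    have hC := hK1 (min ε 1)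
    refine ⟨K (min ε 1), by linarith, fun x => ⟨?_, ?_⟩⟩
    · refine le_trans ?_ (hone x)
      rw [div_le_one (by linarith)]
      refine le_trans (Real.exp_le_one_iff.2 ?_) hC
      have : 0 ≤ ε * ‖x‖ ^ 2 := by positivity
      linarith
    · refine (expEnvelope_le hK0 _ hδ (min_le_right _ _)).trans ?_
      have := hK0 _ hδ
      gcongr
      exact min_le_left _ _
end
end

section
/- Let d ≥ 1 and let ω : ℝ^d → (0,∞) be locally bounded, bounded from below by a positive constant on every compact set, satisfy condition (L), and satisfy: for every ε > 0 there is C > 0 with C⁻¹ e^{−ε|x|²} ≤ ω(x) ≤ C e^{ε|x|²} for all x. Define ω₁(x) = inf_{|z| = |x|} ω(z) and ω₂(x) = sup_{|z| = |x|} ω(z). Then ω₁ and ω₂ are rotation invariant, ω₁(x) ≤ ω(x) ≤ ω₂(x) for all x, and both ω₁ and ω₂ satisfy condition (L) (with possibly different constants) as well as the two-sided bound: for every ε > 0 there is C > 0 with C⁻¹ e^{−ε|x|²} ≤ ω_j(x) ≤ C e^{ε|x|²} for all x, j = 1, 2. -/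
open MeasureTheory Filter
open scoped ENNReal

noncomputable section

/-- The infimum of `ω` over the sphere through `x`. -/
def sphInf {d : ℕ} (ω : RSp d → ℝ) (x : RSp d) : ℝ :=
  ⨅ z : {z : RSp d // ‖z‖ = ‖x‖}, ω z.1

/-- The supremum of `ω` over the sphere through `x`. -/
def sphSup {d : ℕ} (ω : RSp d → ℝ) (x : RSp d) : ℝ :=
  ⨆ z : {z : RSp d // ‖z‖ = ‖x‖}, ω z.1

/-- Every point of the sphere through `a` lies within `‖b - a‖` of the sphere through `b`. -/
lemma exists_norm_eq_norm_sub_le {E : Type*} [NormedAddCommGroup E] [NormedSpace ℝ E]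
    {a z : E} (b : E) (hz : ‖z‖ = ‖a‖) : ∃ w : E, ‖w‖ = ‖b‖ ∧ ‖w - z‖ ≤ ‖b - a‖ := by
  by_cases ha : ‖a‖ = 0
  · have hz0 : z = 0 := norm_eq_zero.mp (hz.trans ha)
    exact ⟨b, rfl, by rw [hz0, norm_eq_zero.mp ha]⟩
  · refine ⟨(‖b‖ / ‖a‖) • z, ?_, ?_⟩
    · rw [norm_smul, Real.norm_of_nonneg (by positivity), hz, div_mul_cancel₀ _ ha]
    · have hsub : (‖b‖ / ‖a‖) • z - z = ((‖b‖ - ‖a‖) / ‖a‖) • z := by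
        rw [sub_div, div_self ha, sub_smul, one_smul]
      rw [hsub, norm_smul, norm_div, norm_norm, hz, div_mul_cancel₀ _ ha]
      exact abs_norm_sub_norm_le b a

section SphericalExtrema

variable {d : ℕ} {ω : RSp d → ℝ}

lemma sphInf_eq_of_norm_eq {x y : RSp d} (h : ‖x‖ = ‖y‖) : sphInf ω x = sphInf ω y := by
  rw [sphInf, sphInf, h]

lemma sphSup_eq_of_norm_eq {x y : RSp d} (h : ‖x‖ = ‖y‖) : sphSup ω x = sphSup ω y := by
  rw [sphSup, sphSup, h]

lemma sphInf_le (hω : ∀ x, 0 < ω x) {x z : RSp d} (hz : ‖z‖ = ‖x‖) : sphInf ω x ≤ ω z :=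
  ciInf_le (f := fun z : {z : RSp d // ‖z‖ = ‖x‖} => ω z.1)
    ⟨0, by rintro _ ⟨z, rfl⟩; exact (hω _).le⟩ ⟨z, hz⟩

lemma le_sphInf {x : RSp d} {m : ℝ} (h : ∀ z, ‖z‖ = ‖x‖ → m ≤ ω z) : m ≤ sphInf ω x :=
  haveI : Nonempty {z : RSp d // ‖z‖ = ‖x‖} := ⟨⟨x, rfl⟩⟩
  le_ciInf fun z => h z.1 z.2

lemma sphSup_le {x : RSp d} {M : ℝ} (h : ∀ z, ‖z‖ = ‖x‖ → ω z ≤ M) : sphSup ω x ≤ M :=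
  haveI : Nonempty {z : RSp d // ‖z‖ = ‖x‖} := ⟨⟨x, rfl⟩⟩
  ciSup_le fun z => h z.1 z.2

lemma le_sphSup (hω : ∀ K : Set (RSp d), IsCompact K → ∃ M, ∀ x ∈ K, ω x ≤ M)
    {x z : RSp d} (hz : ‖z‖ = ‖x‖) : ω z ≤ sphSup ω x := by
  obtain ⟨M, hM⟩ := hω _ (isCompact_sphere (0 : RSp d) ‖x‖)
  refine le_ciSup (f := fun z : {z : RSp d // ‖z‖ = ‖x‖} => ω z.1) ⟨M, ?_⟩ ⟨z, hz⟩
  rintro _ ⟨z, rfl⟩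
  exact hM _ (by simpa using z.2)

/-- Under the bounds of condition (L), the spheres through `x` and `x + y` can be matched
pointwise, in both directions, with comparable values of `ω`. -/
lemma sphere_comparison {c C : ℝ}
    (h : ∀ x y : RSp d, 2 * c ≤ ‖x‖ → ‖y‖ ≤ c / ‖x‖ → ω x / C ≤ ω (x + y) ∧ ω (x + y) ≤ C * ω x)
    {x y : RSp d} (hx : 2 * c ≤ ‖x‖) (hy : ‖y‖ ≤ c / ‖x‖) :
    (∀ z, ‖z‖ = ‖x‖ → ∃ w, ‖w‖ = ‖x + y‖ ∧ ω z / C ≤ ω w ∧ ω w ≤ C * ω z) ∧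
    (∀ w, ‖w‖ = ‖x + y‖ → ∃ z, ‖z‖ = ‖x‖ ∧ ω z / C ≤ ω w ∧ ω w ≤ C * ω z) := by
  have close : ∀ z w : RSp d, ‖z‖ = ‖x‖ → ‖w - z‖ ≤ ‖y‖ → ω z / C ≤ ω w ∧ ω w ≤ C * ω z := by
    intro z w hz hwz
    simpa using h z (w - z) (hz ▸ hx) (hz ▸ hwz.trans hy)
  constructor
  · intro z hz
    obtain ⟨w, hw, hwz⟩ := exists_norm_eq_norm_sub_le (x + y) hz
    exact ⟨w, hw, close z w hz (by simpa using hwz)⟩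
  · intro w hw
    obtain ⟨z, hz, hzw⟩ := exists_norm_eq_norm_sub_le x hw
    exact ⟨z, hz, close z w hz (by simpa [norm_sub_rev w z] using hzw)⟩

lemma CondL.sphInf (hL : CondL ω) (hω : ∀ x, 0 < ω x) : CondL (sphInf ω) := by
  obtain ⟨c, C, hc, hC, h⟩ := hL
  refine ⟨c, C, hc, hC, fun x y hx hy => ?_⟩
  obtain ⟨hto, hfrom⟩ := sphere_comparison h hx hy
  constructor
  · refine le_sphInf fun w hw => ?_
    obtain ⟨z, hz, hle, -⟩ := hfrom w hw
    exact (div_le_div_of_nonneg_right (sphInf_le hω hz) hC.le).trans hle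
  · rw [← div_le_iff₀' hC]
    refine le_sphInf fun z hz => ?_
    obtain ⟨w, hw, -, hle⟩ := hto z hz
    exact (div_le_iff₀' hC).mpr ((sphInf_le hω hw).trans hle)

lemma CondL.sphSup (hL : CondL ω)
    (hω : ∀ K : Set (RSp d), IsCompact K → ∃ M, ∀ x ∈ K, ω x ≤ M) : CondL (sphSup ω) := by
  obtain ⟨c, C, hc, hC, h⟩ := hL
  refine ⟨c, C, hc, hC, fun x y hx hy => ?_⟩
  obtain ⟨hto, hfrom⟩ := sphere_comparison h hx hy
  constructor
  · rw [div_le_iff₀ hC]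
    refine sphSup_le fun z hz => ?_
    obtain ⟨w, hw, hle, -⟩ := hto z hz
    exact (div_le_iff₀ hC).mp (hle.trans (le_sphSup hω hw))
  · refine sphSup_le fun w hw => ?_
    obtain ⟨z, hz, -, hle⟩ := hfrom w hw
    exact hle.trans (mul_le_mul_of_nonneg_left (le_sphSup hω hz) hC.le)

end SphericalExtrema

/-- for a weight satisfying (L) and all two-sided Gaussian bounds, the radial
minorant `ω₁` and majorant `ω₂` are rotation invariant, sandwich `ω`, and again satisfy (L)
and all two-sided Gaussian bounds. -/
theorem stmt18 (d : ℕ) (hd : 1 ≤ d)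
    (ω : RSp d → ℝ) (hωpos : ∀ x, 0 < ω x)
    (hloc : ∀ K : Set (RSp d), IsCompact K → ∃ m M : ℝ, 0 < m ∧ ∀ x ∈ K, m ≤ ω x ∧ ω x ≤ M)
    (hL : CondL ω)
    (hgauss : ∀ ε : ℝ, 0 < ε → ∃ C : ℝ, 0 < C ∧ ∀ x : RSp d,
      Real.exp (-(ε * ‖x‖ ^ 2)) / C ≤ ω x ∧ ω x ≤ C * Real.exp (ε * ‖x‖ ^ 2)) :
    (∀ x y : RSp d, ‖x‖ = ‖y‖ → sphInf ω x = sphInf ω y ∧ sphSup ω x = sphSup ω y) ∧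
    (∀ x : RSp d, sphInf ω x ≤ ω x ∧ ω x ≤ sphSup ω x) ∧
    CondL (sphInf ω) ∧ CondL (sphSup ω) ∧
    (∀ ε : ℝ, 0 < ε → ∃ C : ℝ, 0 < C ∧ ∀ x : RSp d,
      (Real.exp (-(ε * ‖x‖ ^ 2)) / C ≤ sphInf ω x ∧ sphInf ω x ≤ C * Real.exp (ε * ‖x‖ ^ 2)) ∧
      (Real.exp (-(ε * ‖x‖ ^ 2)) / C ≤ sphSup ω x ∧
        sphSup ω x ≤ C * Real.exp (ε * ‖x‖ ^ 2))) := by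
  have hbdd : ∀ K : Set (RSp d), IsCompact K → ∃ M, ∀ x ∈ K, ω x ≤ M := fun K hK =>
    let ⟨_, M, _, h⟩ := hloc K hK
    ⟨M, fun x hx => (h x hx).2⟩
  refine ⟨fun x y h => ⟨sphInf_eq_of_norm_eq h, sphSup_eq_of_norm_eq h⟩,
    fun x => ⟨sphInf_le hωpos rfl, le_sphSup hbdd rfl⟩, hL.sphInf hωpos, hL.sphSup hbdd,
    fun ε hε => ?_⟩
  obtain ⟨C, hC, h⟩ := hgauss ε hε
  exact ⟨C, hC, fun x =>
    ⟨⟨le_sphInf fun z hz => hz ▸ (h z).1, (sphInf_le hωpos rfl).trans (h x).2⟩,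
      (h x).1.trans (le_sphSup hbdd rfl), sphSup_le fun z hz => hz ▸ (h z).2⟩⟩
end
end

section
/- Let d ≥ 1, r > 0, s ∈ ℝ \ {0}, and define ω on ℝ^{2d} = ℝ^d × ℝ^d by ω(x,ξ) = (1 + |x|^r |ξ|^r)^s. Then: (a) ω satisfies condition (L) on ℝ^{2d} (there are c, C > 0 with C⁻¹ ω(X) ≤ ω(X+Y) ≤ C ω(X) whenever |X| ≥ 2c and |Y| ≤ c/|X|, X, Y ∈ ℝ^{2d}); (b) there are C > 0 and N ≥ 0 with ω(X) + 1/ω(X) ≤ C (1+|X|)^N for all X; and (c) ω is not moderate: there exist no constant C > 0 and function v : ℝ^{2d} → (0,∞) such that ω(X+Y) ≤ C ω(X) v(Y) for all X, Y ∈ ℝ^{2d}. -/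
open MeasureTheory Filter
open scoped ENNReal

noncomputable section

/-- The Euclidean norm of `X = (x,ξ) ∈ ℝ^{2d} = ℝ^d × ℝ^d`. -/
def norm2d {d : ℕ} (X : RSp d × RSp d) : ℝ := Real.sqrt (‖X.1‖ ^ 2 + ‖X.2‖ ^ 2)

/-- The weight `ω(x,ξ) = (1 + |x|^r |ξ|^r)^s` on `ℝ^{2d}`. -/
def crossWeight {d : ℕ} (r s : ℝ) (X : RSp d × RSp d) : ℝ :=
  (1 + ‖X.1‖ ^ r * ‖X.2‖ ^ r) ^ s

lemma one_le_crossWeight_base {d : ℕ} (r : ℝ) (X : RSp d × RSp d) :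
    1 ≤ 1 + ‖X.1‖ ^ r * ‖X.2‖ ^ r :=
  le_add_of_nonneg_right (by positivity)

lemma norm_fst_le_norm2d {d : ℕ} (X : RSp d × RSp d) : ‖X.1‖ ≤ norm2d X :=
  Real.le_sqrt_of_sq_le (by nlinarith [sq_nonneg ‖X.2‖])

lemma norm_snd_le_norm2d {d : ℕ} (X : RSp d × RSp d) : ‖X.2‖ ≤ norm2d X :=
  Real.le_sqrt_of_sq_le (by nlinarith [sq_nonneg ‖X.1‖])

/-- Comparable positive numbers have comparable real powers, whatever the sign of the exponent. -/
lemma rpow_le_rpow_abs_mul_rpow {A B K : ℝ} (hA : 0 < A) (hB : 0 < B) (hK : 0 < K)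
    (hAB : A ≤ K * B) (hBA : B ≤ K * A) (s : ℝ) : A ^ s ≤ K ^ |s| * B ^ s := by
  rcases le_total 0 s with hs | hs
  · rw [abs_of_nonneg hs, ← Real.mul_rpow hK.le hB.le]
    exact Real.rpow_le_rpow hA.le hAB hs
  · have h : (K * A) ^ s ≤ B ^ s := Real.rpow_le_rpow_of_nonpos hB hBA hs
    rw [Real.mul_rpow hK.le hA.le] at h
    rw [abs_of_nonpos hs]
    calc A ^ s = K ^ (-s) * (K ^ s * A ^ s) := by
          rw [← mul_assoc, ← Real.rpow_add hK, neg_add_cancel, Real.rpow_zero, one_mul]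
      _ ≤ K ^ (-s) * B ^ s := by gcongr

lemma one_add_rpow_le {p q r : ℝ} (hp : 0 ≤ p) (hq : 0 ≤ q) (hr : 0 < r) (h : q ≤ p + 3) :
    1 + q ^ r ≤ (1 + 4 ^ r) * (1 + p ^ r) := by
  have h4 : (0 : ℝ) < 4 ^ r := by positivity
  have hpr : 0 ≤ p ^ r := by positivity
  have key : q ^ r ≤ 4 ^ r * (1 + p ^ r) := by
    rcases le_total p 1 with h1 | h1
    · calc q ^ r ≤ 4 ^ r := Real.rpow_le_rpow hq (by linarith) hr.le
        _ ≤ 4 ^ r * (1 + p ^ r) := by nlinarith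
    · calc q ^ r ≤ (4 * p) ^ r := Real.rpow_le_rpow hq (by linarith) hr.le
        _ = 4 ^ r * p ^ r := Real.mul_rpow (by norm_num) hp
        _ ≤ 4 ^ r * (1 + p ^ r) := by nlinarith
  nlinarith

/-- If each factor moves by at most `δ`, where `δ * R ≤ 1` and `δ ≤ 1 / 2`, the product grows by
at most `3`. -/
lemma mul_le_mul_add_three {a b a' b' R δ : ℝ} (hb' : 0 ≤ b') (ha : 0 ≤ a)
    (hδ : 0 ≤ δ) (hδ2 : δ ≤ 1 / 2) (hR : δ * R ≤ 1) (haR : a ≤ R + δ)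
    (hbR : b ≤ R + δ) (haa : a' ≤ a + δ) (hbb : b' ≤ b + δ) : a' * b' ≤ a * b + 3 := by
  have h1 : a' * b' ≤ (a + δ) * (b + δ) := by gcongr
  nlinarith [mul_le_mul_of_nonneg_left haR hδ, mul_le_mul_of_nonneg_left hbR hδ,
    mul_le_mul hδ2 hδ2 hδ (by norm_num)]

lemma crossWeight_le_of_norm2d_le {d : ℕ} {r : ℝ} (s : ℝ) (hr : 0 < r) {X Y : RSp d × RSp d}
    (hX : 2 ≤ norm2d X) (hY : norm2d Y ≤ 1 / norm2d X) :
    crossWeight r s (X + Y) ≤ (1 + 4 ^ r) ^ |s| * crossWeight r s X ∧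
      crossWeight r s X ≤ (1 + 4 ^ r) ^ |s| * crossWeight r s (X + Y) := by
  have hX0 : 0 < norm2d X := by linarith
  have hmul : norm2d Y * norm2d X ≤ 1 := (le_div_iff₀ hX0).1 hY
  have hY0 : 0 ≤ norm2d Y := Real.sqrt_nonneg _
  have hY2 : norm2d Y ≤ 1 / 2 := by nlinarith
  have hx := norm_fst_le_norm2d X
  have hξ := norm_snd_le_norm2d X
  have hy := norm_fst_le_norm2d Y
  have hη := norm_snd_le_norm2d Y
  have e1 : ‖(X + Y).1‖ ≤ ‖X.1‖ + norm2d Y := (norm_add_le X.1 Y.1).trans (by gcongr)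
  have e2 : ‖(X + Y).2‖ ≤ ‖X.2‖ + norm2d Y := (norm_add_le X.2 Y.2).trans (by gcongr)
  have e3 : ‖X.1‖ ≤ ‖(X + Y).1‖ + norm2d Y := (norm_le_add_norm_add X.1 Y.1).trans (by gcongr; rfl)
  have e4 : ‖X.2‖ ≤ ‖(X + Y).2‖ + norm2d Y := (norm_le_add_norm_add X.2 Y.2).trans (by gcongr; rfl)
  have p1 : ‖(X + Y).1‖ * ‖(X + Y).2‖ ≤ ‖X.1‖ * ‖X.2‖ + 3 :=
    mul_le_mul_add_three (norm_nonneg _) (norm_nonneg _) hY0 hY2 hmul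
      (by linarith) (by linarith) e1 e2
  have p2 : ‖X.1‖ * ‖X.2‖ ≤ ‖(X + Y).1‖ * ‖(X + Y).2‖ + 3 :=
    mul_le_mul_add_three (norm_nonneg _) (norm_nonneg _) hY0 hY2 hmul
      (by linarith) (by linarith) e3 e4
  have q1 := one_add_rpow_le (by positivity) (by positivity) hr p1
  have q2 := one_add_rpow_le (by positivity) (by positivity) hr p2
  rw [Real.mul_rpow (norm_nonneg _) (norm_nonneg _),
    Real.mul_rpow (norm_nonneg _) (norm_nonneg _)] at q1 q2
  exact ⟨rpow_le_rpow_abs_mul_rpow (by positivity) (by positivity) (by positivity) q1 q2 s,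
    rpow_le_rpow_abs_mul_rpow (by positivity) (by positivity) (by positivity) q2 q1 s⟩

lemma crossWeight_add_inv_le {d : ℕ} {r s : ℝ} (hr : 0 < r) {m n : ℕ} (hm : r ≤ m)
    (hn : |s| ≤ n) (X : RSp d × RSp d) :
    crossWeight r s X + (crossWeight r s X)⁻¹ ≤
      2 * 2 ^ n * (1 + norm2d X) ^ ((m + m) * n) := by
  have hA1 := one_le_crossWeight_base r X
  have hR0 : 0 ≤ norm2d X := Real.sqrt_nonneg _
  have factor : ∀ a : ℝ, 0 ≤ a → a ≤ norm2d X → a ^ r ≤ (1 + norm2d X) ^ m := fun a ha h ↦ by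
    calc a ^ r ≤ (1 + norm2d X) ^ r := Real.rpow_le_rpow ha (by linarith) hr.le
      _ ≤ (1 + norm2d X) ^ (m : ℝ) := Real.rpow_le_rpow_of_exponent_le (by linarith) hm
      _ = (1 + norm2d X) ^ m := Real.rpow_natCast _ _
  have hA : 1 + ‖X.1‖ ^ r * ‖X.2‖ ^ r ≤ 2 * (1 + norm2d X) ^ (m + m) := by
    have h1 : 1 ≤ (1 + norm2d X) ^ (m + m) := one_le_pow₀ (by linarith)
    have h2 : ‖X.1‖ ^ r * ‖X.2‖ ^ r ≤ (1 + norm2d X) ^ (m + m) := by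
      rw [pow_add]
      exact mul_le_mul (factor _ (norm_nonneg _) (norm_fst_le_norm2d X))
        (factor _ (norm_nonneg _) (norm_snd_le_norm2d X)) (by positivity) (by positivity)
    linarith
  have power : ∀ t : ℝ, t ≤ n →
      (1 + ‖X.1‖ ^ r * ‖X.2‖ ^ r) ^ t ≤ 2 ^ n * (1 + norm2d X) ^ ((m + m) * n) := fun t ht ↦ by
    calc (1 + ‖X.1‖ ^ r * ‖X.2‖ ^ r) ^ t
        ≤ (1 + ‖X.1‖ ^ r * ‖X.2‖ ^ r) ^ (n : ℝ) := Real.rpow_le_rpow_of_exponent_le hA1 ht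
      _ = (1 + ‖X.1‖ ^ r * ‖X.2‖ ^ r) ^ n := Real.rpow_natCast _ _
      _ ≤ (2 * (1 + norm2d X) ^ (m + m)) ^ n := by gcongr
      _ = _ := by rw [mul_pow, pow_mul]
  have h1 := power s ((le_abs_self s).trans hn)
  have h2 := power (-s) ((neg_le_abs s).trans hn)
  rw [Real.rpow_neg (by positivity)] at h2
  unfold crossWeight
  linarith

lemma exists_lt_one_add_rpow_rpow {r u : ℝ} (hr : 0 < r) (hu : 0 < u) {M : ℝ} (hM : 0 < M) :
    ∃ t : ℝ, 0 < t ∧ M < (1 + t ^ r) ^ u := by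
  refine ⟨(M ^ u⁻¹) ^ r⁻¹, by positivity, ?_⟩
  rw [Real.rpow_inv_rpow (by positivity) hr.ne']
  calc M = (M ^ u⁻¹) ^ u := (Real.rpow_inv_rpow hM.le hu.ne').symm
    _ < (1 + M ^ u⁻¹) ^ u := Real.rpow_lt_rpow (by positivity) (by linarith) hu

lemma not_crossWeight_moderate {d : ℕ} (hd : 1 ≤ d) {r s : ℝ} (hr : 0 < r) (hs : s ≠ 0)
    {C : ℝ} (hC : 0 < C) {v : RSp d × RSp d → ℝ} (hv : ∀ Y, 0 < v Y) :
    ¬ ∀ X Y : RSp d × RSp d, crossWeight r s (X + Y) ≤ C * crossWeight r s X * v Y := by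
  intro h
  have : Nonempty (Fin d) := ⟨⟨0, hd⟩⟩
  obtain ⟨e, he⟩ := exists_norm_eq (RSp d) zero_le_one
  rcases hs.lt_or_gt with hs | hs
  · obtain ⟨t, ht, hlt⟩ := exists_lt_one_add_rpow_rpow hr (neg_pos.2 hs)
      (mul_pos hC (hv (0, -e)))
    have h1 := h (t • e, e) (0, -e)
    simp only [crossWeight, Prod.mk_add_mk, add_zero, add_neg_cancel, norm_zero, norm_smul, he,
      Real.zero_rpow hr.ne', Real.norm_of_nonneg ht.le, mul_one, mul_zero, Real.one_rpow] at h1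
    have hpos : 0 < (1 + t ^ r) ^ s := by positivity
    rw [Real.rpow_neg (by positivity), ← one_div, lt_div_iff₀ hpos] at hlt
    linarith
  · obtain ⟨t, ht, hlt⟩ := exists_lt_one_add_rpow_rpow hr hs (mul_pos hC (hv (0, e)))
    have h1 := h (t • e, 0) (0, e)
    simp only [crossWeight, Prod.mk_add_mk, add_zero, zero_add, norm_zero, norm_smul, he,
      Real.zero_rpow hr.ne', Real.norm_of_nonneg ht.le, mul_one, mul_zero, Real.one_rpow] at h1
    linarith

/-- for `r > 0` and `s ≠ 0`, the weight `ω(x,ξ) = (1+|x|^r|ξ|^r)^s` on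
`ℝ^{2d}` satisfies (a) condition (L), (b) a two-sided polynomial bound, but (c) is not
moderate: no `C > 0` and positive `v` satisfy `ω(X+Y) ≤ C ω(X) v(Y)` for all `X, Y`. -/
theorem stmt19 (d : ℕ) (hd : 1 ≤ d) (r s : ℝ) (hr : 0 < r) (hs : s ≠ 0) :
    (∃ c C : ℝ, 0 < c ∧ 0 < C ∧ ∀ X Y : RSp d × RSp d,
      2 * c ≤ norm2d X → norm2d Y ≤ c / norm2d X →
        crossWeight r s X / C ≤ crossWeight r s (X + Y) ∧
          crossWeight r s (X + Y) ≤ C * crossWeight r s X) ∧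
    (∃ C : ℝ, 0 < C ∧ ∃ N : ℕ, ∀ X : RSp d × RSp d,
      crossWeight r s X + (crossWeight r s X)⁻¹ ≤ C * (1 + norm2d X) ^ N) ∧
    (∀ (C : ℝ), 0 < C → ∀ v : RSp d × RSp d → ℝ, (∀ Y, 0 < v Y) →
      ¬ ∀ X Y : RSp d × RSp d, crossWeight r s (X + Y) ≤ C * crossWeight r s X * v Y) := by
  refine ⟨⟨1, (1 + 4 ^ r) ^ |s|, one_pos, by positivity, fun X Y hX hY ↦ ?_⟩, ?_,
    fun C hC v hv ↦ not_crossWeight_moderate hd hr hs hC hv⟩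
  · obtain ⟨h1, h2⟩ := crossWeight_le_of_norm2d_le s hr (by linarith) hY
    exact ⟨(div_le_iff₀' (by positivity)).2 h2, h1⟩
  · obtain ⟨m, hm⟩ := exists_nat_ge r
    obtain ⟨n, hn⟩ := exists_nat_ge |s|
    exact ⟨_, by positivity, _, crossWeight_add_inv_le hr hm hn⟩
end
end
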